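/- arXiv:2304.07674 — 4 statements merged into one kernel-verified Lean document; each statement's English description precedes it below -/
import Mathlib

section
/- Let k ≥ 1 be an integer and let G=(V,E) be a finite connected graph that is k-edge-connected, i.e., |δ(S)| ≥ k for every nonempty proper subset S ⊂ V. Let L be a laminar family of nonempty proper subsets of V. Then there exists a spanning tree T of G such that for every S ∈ L, |T ∩ δ(S)| ≤ (2·(2+√7)²/k)·|δ(S)|; in particular |T ∩ δ(S)| ≤ (44/k)·|δ(S)|. -/
open scoped Classical
open Finset

noncomputable section

variable {V : Type}

/-- The set of edges of `G` with exactly one endpoint in `S`. -/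
def cutEdges [Fintype V] (G : SimpleGraph V) (S : Set V) : Finset (Sym2 V) :=
  Finset.univ.filter (fun e => e ∈ G.edgeSet ∧ ∃ u v, e = s(u, v) ∧ u ∈ S ∧ v ∉ S)

/-- The set of edges of `G` with both endpoints in `S`. -/
def insideEdges [Fintype V] (G : SimpleGraph V) (S : Set V) : Finset (Sym2 V) :=
  Finset.univ.filter (fun e => e ∈ G.edgeSet ∧ ∀ v ∈ e, v ∈ S)

/-- A family of sets is laminar if any two members are disjoint or nested. -/
def Laminar (L : Set (Set V)) : Prop :=
  ∀ S T, S ∈ L → T ∈ L → S ∩ T = ∅ ∨ S ∩ T = S ∨ S ∩ T = T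

/-- The spanning tree polytope of `G` : the convex hull of the indicator vectors of
the edge sets of spanning trees of `G`. -/
def stPolytope [Fintype V] (G : SimpleGraph V) : Set (Sym2 V → ℝ) :=
  convexHull ℝ { y | ∃ T : SimpleGraph V, T ≤ G ∧ T.IsTree ∧
      y = fun e => if e ∈ T.edgeSet then (1 : ℝ) else 0 }

/-- `x` is `L`-aligned: for every `S ∈ L`, the restriction of `x` to `E(S)` lies in the
spanning tree polytope of the induced subgraph `G[S]`. -/
def IsAligned [Fintype V] (G : SimpleGraph V) (L : Set (Set V)) (x : Sym2 V → ℝ) : Prop :=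
  ∀ S ∈ L, (fun e : Sym2 S => x (e.map Subtype.val)) ∈ stPolytope (G.induce S)

/-- All endpoints of `e` lie in `U`. -/
def Inside (U : Finset V) (e : Sym2 V) : Prop := ∀ v ∈ e, v ∈ U

/-- Some endpoint of `e` lies in `U`. -/
def Touches (U : Finset V) (e : Sym2 V) : Prop := ∃ v ∈ e, v ∈ U

/-- `e` has exactly one endpoint in `U`. -/
def Crosses (U : Finset V) (e : Sym2 V) : Prop := Touches U e ∧ ¬ Inside U e

lemma inside_mk {U : Finset V} {a b : V} : Inside U s(a, b) ↔ a ∈ U ∧ b ∈ U := by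
  simp [Inside]

lemma touches_mk {U : Finset V} {a b : V} : Touches U s(a, b) ↔ a ∈ U ∨ b ∈ U := by
  simp [Touches]

lemma inside_inter {Y Z : Finset V} {e : Sym2 V} :
    Inside (Y ∩ Z) e ↔ Inside Y e ∧ Inside Z e := by
  simp only [Inside, Finset.mem_inter]
  exact forall₂_and

lemma Inside.mono {Y Z : Finset V} (h : Y ⊆ Z) {e : Sym2 V} (he : Inside Y e) : Inside Z e :=
  fun v hv => h (he v hv)

lemma Touches.mono {Y Z : Finset V} (h : Y ⊆ Z) {e : Sym2 V} (he : Touches Y e) :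
    Touches Z e := by
  obtain ⟨v, hv, hvY⟩ := he
  exact ⟨v, hv, h hvY⟩

lemma Inside.touches {Y : Finset V} {e : Sym2 V} (he : Inside Y e) : Touches Y e := by
  induction e using Sym2.ind with
  | _ a b => rw [inside_mk] at he; rw [touches_mk]; exact Or.inl he.1

lemma inside_univ [Fintype V] (e : Sym2 V) : Inside Finset.univ e := fun _ _ => Finset.mem_univ _

lemma Inside.inter_nonempty {Y Z : Finset V} {e : Sym2 V} (hY : Inside Y e) (hZ : Inside Z e) :
    (Y ∩ Z).Nonempty := by
  obtain ⟨v, -, hv⟩ := (inside_inter.2 ⟨hY, hZ⟩).touches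
  exact ⟨v, hv⟩

/-- The `x`-weight of the edges inside `U`. -/
def insideWeight [Fintype V] (x : Sym2 V → ℝ) (U : Finset V) : ℝ :=
  ∑ e with Inside U e, x e

/-- The `x`-weight of the edges crossing `U`. -/
def cutWeight [Fintype V] (x : Sym2 V → ℝ) (U : Finset V) : ℝ :=
  ∑ e with Crosses U e, x e

/-- Nonnegative vectors supported on `G` satisfying the subtour inequalities. -/
structure IsSubtour [Fintype V] (G : SimpleGraph V) (x : Sym2 V → ℝ) : Prop where
  nonneg : ∀ e, 0 ≤ x e
  support : ∀ e, e ∉ G.edgeSet → x e = 0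
  le : ∀ U : Finset V, U.Nonempty → insideWeight x U ≤ (U.card : ℝ) - 1

/-- `U` is nonempty and its subtour inequality is an equality. -/
def Tight [Fintype V] (x : Sym2 V → ℝ) (U : Finset V) : Prop :=
  U.Nonempty ∧ insideWeight x U = (U.card : ℝ) - 1

section Uncrossing

variable [Fintype V] {G : SimpleGraph V} {x : Sym2 V → ℝ}

lemma insideWeight_eq_sum_ite (x : Sym2 V → ℝ) (U : Finset V) :
    insideWeight x U = ∑ e, if Inside U e then x e else 0 := by
  rw [insideWeight, Finset.sum_filter]

lemma IsSubtour.le_one (hx : IsSubtour G x) (e : Sym2 V) : x e ≤ 1 := by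
  by_cases he : e ∈ G.edgeSet
  · induction e using Sym2.ind with
    | _ a b =>
      have hab : a ≠ b := G.ne_of_adj (by simpa using he)
      have h := hx.le {a, b} ⟨a, by simp⟩
      rw [Finset.card_pair hab] at h
      have h2 : x s(a, b) ≤ insideWeight x {a, b} :=
        Finset.single_le_sum (f := x) (fun e _ => hx.nonneg e)
          (by simp [inside_mk])
      norm_num at h
      linarith
  · rw [hx.support e he]; norm_num

lemma tight_pair (hx : IsSubtour G x) {a b : V} (hab : a ≠ b) (h1 : x s(a, b) = 1) :
    Tight x {a, b} := by
  refine ⟨⟨a, by simp⟩, le_antisymm (hx.le _ ⟨a, by simp⟩) ?_⟩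
  rw [Finset.card_pair hab]
  have h2 : x s(a, b) ≤ insideWeight x {a, b} :=
    Finset.single_le_sum (f := x) (fun e _ => hx.nonneg e)
      (by simp [inside_mk])
  norm_num
  linarith

/-- Intersecting tight sets uncross, and no positive edge joins their differences. -/
lemma Tight.uncross (hx : IsSubtour G x) {Y Z : Finset V} (hY : Tight x Y) (hZ : Tight x Z)
    (hYZ : (Y ∩ Z).Nonempty) :
    Tight x (Y ∩ Z) ∧ Tight x (Y ∪ Z) ∧
      ∀ e, x e ≠ 0 → Inside (Y ∪ Z) e → Inside Y e ∨ Inside Z e := by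
  have hU : (Y ∪ Z).Nonempty := hYZ.mono (Finset.inter_subset_left.trans Finset.subset_union_left)
  have hterm : ∀ e ∈ (Finset.univ : Finset (Sym2 V)),
      ((if Inside Y e then x e else 0) + if Inside Z e then x e else 0) ≤
      ((if Inside (Y ∪ Z) e then x e else 0) + if Inside (Y ∩ Z) e then x e else 0) := by
    intro e _
    have h0 := hx.nonneg e
    have hl : Inside Y e → Inside (Y ∪ Z) e := Inside.mono Finset.subset_union_left
    have hr : Inside Z e → Inside (Y ∪ Z) e := Inside.mono Finset.subset_union_right
    rw [inside_inter]
    by_cases h1 : Inside Y e <;> by_cases h2 : Inside Z e <;> simp [h1, h2, hl, hr]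
    split_ifs <;> simp [h0]
  have hcard : ((Y ∪ Z).card : ℝ) + (Y ∩ Z).card = Y.card + Z.card := by
    exact_mod_cast Finset.card_union_add_card_inter Y Z
  have hsum := Finset.sum_le_sum hterm
  have h1 := hx.le _ hU
  have h2 := hx.le _ hYZ
  have h3 := hY.2
  have h4 := hZ.2
  have hsum' := hsum
  rw [Finset.sum_add_distrib, Finset.sum_add_distrib, ← insideWeight_eq_sum_ite,
    ← insideWeight_eq_sum_ite, ← insideWeight_eq_sum_ite, ← insideWeight_eq_sum_ite] at hsum'
  refine ⟨⟨hYZ, by linarith⟩, ⟨hU, by linarith⟩, ?_⟩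
  have heq := (Finset.sum_eq_sum_iff_of_le hterm).1 (by
    rw [Finset.sum_add_distrib, Finset.sum_add_distrib, ← insideWeight_eq_sum_ite,
      ← insideWeight_eq_sum_ite, ← insideWeight_eq_sum_ite, ← insideWeight_eq_sum_ite]
    linarith)
  intro e he hin
  by_contra hcon
  push Not at hcon
  have := heq e (Finset.mem_univ e)
  rw [inside_inter] at this
  simp [hcon.1, hcon.2, hin] at this
  exact he this.symm

/-- Every edge lying inside a tight set lies inside a smallest one. -/
lemma exists_min_tight (hx : IsSubtour G x) (hV : Tight x Finset.univ) (e : Sym2 V) :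
    ∃ U, Tight x U ∧ Inside U e ∧ ∀ Y, Tight x Y → Inside Y e → U ⊆ Y := by
  obtain ⟨U, hU, hmin⟩ := Finset.exists_min_image
    (Finset.univ.filter fun U : Finset V => Tight x U ∧ Inside U e) Finset.card
    ⟨Finset.univ, by simp [hV, inside_univ]⟩
  simp only [Finset.mem_filter, Finset.mem_univ, true_and] at hU hmin
  refine ⟨U, hU.1, hU.2, fun Y hY hYe => ?_⟩
  have hun := hU.1.uncross hx hY (hU.2.inter_nonempty hYe)
  have := hmin (U ∩ Y) ⟨hun.1, inside_inter.2 ⟨hU.2, hYe⟩⟩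
  exact Finset.inter_eq_left.1 (Finset.eq_of_subset_of_card_le Finset.inter_subset_left this)

/-- The smallest tight set containing both endpoints of `e`. -/
def hull (hx : IsSubtour G x) (hV : Tight x Finset.univ) (e : Sym2 V) : Finset V :=
  (exists_min_tight hx hV e).choose

lemma hull_tight (hx : IsSubtour G x) (hV : Tight x Finset.univ) (e : Sym2 V) :
    Tight x (hull hx hV e) := (exists_min_tight hx hV e).choose_spec.1

lemma inside_hull (hx : IsSubtour G x) (hV : Tight x Finset.univ) (e : Sym2 V) :
    Inside (hull hx hV e) e := (exists_min_tight hx hV e).choose_spec.2.1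

lemma hull_subset_iff (hx : IsSubtour G x) (hV : Tight x Finset.univ) {e : Sym2 V}
    {Y : Finset V} (hY : Tight x Y) : hull hx hV e ⊆ Y ↔ Inside Y e :=
  ⟨fun h => (inside_hull hx hV e).mono h, (exists_min_tight hx hV e).choose_spec.2.2 Y hY⟩

/-- The union of tight sets, each inducing integral weight, has integral inside weight. -/
lemma exists_int_sum_inside_list (hx : IsSubtour G x) (n : ℕ) :
    ∀ l : List (Finset V), l.length = n → (∀ Y ∈ l, Y = ∅ ∨ Tight x Y) →
      ∃ m : ℤ, (m : ℝ) = ∑ e with ∃ Y ∈ l, Inside Y e, x e := by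
  induction n with
  | zero =>
    intro l hl _
    rw [List.length_eq_zero_iff] at hl
    subst hl
    exact ⟨0, by simp⟩
  | succ n ih =>
    intro l hl hgood
    match l, hl, hgood with
    | Y :: l, hl, hgood =>
      have hlen : l.length = n := by simpa using hl
      have hgl : ∀ Z ∈ l, Z = ∅ ∨ Tight x Z := fun Z hZ => hgood Z (List.mem_cons_of_mem _ hZ)
      have hgY := hgood Y List.mem_cons_self
      obtain ⟨m1, h1⟩ := ih l hlen hgl
      obtain ⟨m2, h2⟩ := ih (l.map (· ∩ Y)) (by simpa using hlen) (by
        intro W hW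
        obtain ⟨Z, hZ, rfl⟩ := List.mem_map.1 hW
        by_cases hne : (Z ∩ Y).Nonempty
        · rcases hgl Z hZ with rfl | hZt
          · simp at hne
          · rcases hgY with rfl | hYt
            · simp at hne
            · exact Or.inr (hZt.uncross hx hYt hne).1
        · exact Or.inl (Finset.not_nonempty_iff_eq_empty.1 hne))
      have h3 : ∃ m3 : ℤ, (m3 : ℝ) = insideWeight x Y := by
        rcases hgY with rfl | hYt
        · refine ⟨0, ?_⟩
          rw [insideWeight, Finset.sum_eq_zero]
          · simp
          · intro e he
            obtain ⟨v, -, hv⟩ := (Finset.mem_filter.1 he).2.touches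
            simp at hv
        · exact ⟨(Y.card : ℤ) - 1, by rw [hYt.2]; push_cast; ring⟩
      obtain ⟨m3, h3⟩ := h3
      refine ⟨m3 + m1 - m2, ?_⟩
      have hun : (Finset.univ.filter fun e => ∃ Z ∈ Y :: l, Inside Z e) =
          (Finset.univ.filter (Inside Y)) ∪ (Finset.univ.filter fun e => ∃ Z ∈ l, Inside Z e) := by
        ext e; simp
      have hin : (Finset.univ.filter fun e => ∃ Z ∈ l.map (· ∩ Y), Inside Z e) =
          (Finset.univ.filter (Inside Y)) ∩ (Finset.univ.filter fun e => ∃ Z ∈ l, Inside Z e) := by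
        ext e
        simp only [List.mem_map, Finset.mem_filter, Finset.mem_univ, true_and, Finset.mem_inter]
        constructor
        · rintro ⟨W, ⟨Z, hZ, rfl⟩, hW⟩
          rw [inside_inter] at hW
          exact ⟨hW.2, Z, hZ, hW.1⟩
        · rintro ⟨hYe, Z, hZ, hZe⟩
          exact ⟨_, ⟨Z, hZ, rfl⟩, inside_inter.2 ⟨hZe, hYe⟩⟩
      have := Finset.sum_union_inter (s₁ := Finset.univ.filter (Inside Y))
        (s₂ := Finset.univ.filter fun e => ∃ Z ∈ l, Inside Z e) (f := x)
      rw [← hun, ← hin, ← h1, ← h2] at this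
      rw [insideWeight] at h3
      rw [← h3] at this
      push_cast
      linarith

/-- The edges of fractional weight. -/
def fracEdges (x : Sym2 V → ℝ) : Finset (Sym2 V) :=
  Finset.univ.filter fun e => x e ≠ 0 ∧ x e ≠ 1

lemma not_int_of_mem_fracEdges (hx : IsSubtour G x) {e : Sym2 V} (he : e ∈ fracEdges x) (m : ℤ) :
    x e ≠ m := by
  intro h
  have h0 := hx.nonneg e
  have h1 := hx.le_one e
  rw [h] at h0 h1
  have h0' : (0 : ℤ) ≤ m := by exact_mod_cast h0
  have h1' : m ≤ (1 : ℤ) := by exact_mod_cast h1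
  have := (Finset.mem_filter.1 he).2
  rw [h] at this
  have h2 : m = 0 ∨ m = 1 := by omega
  rcases h2 with rfl | rfl
  · simp at this
  · simp at this

/-- The fractional edges having the same hull as a given one. -/
def hullClass (hx : IsSubtour G x) (hV : Tight x Finset.univ) (U : Finset V) :
    Finset (Sym2 V) :=
  (fracEdges x).filter fun f => hull hx hV f = U

lemma two_le_card_hullClass (hx : IsSubtour G x) (hV : Tight x Finset.univ) {e : Sym2 V}
    (he : e ∈ fracEdges x) : 2 ≤ (hullClass hx hV (hull hx hV e)).card := by
  set U := hull hx hV e with hU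
  have hmem : e ∈ hullClass hx hV U := by simp [hullClass, he, ← hU]
  by_contra hlt
  have hone : (hullClass hx hV U).card = 1 := by
    have : 0 < (hullClass hx hV U).card := Finset.card_pos.2 ⟨e, hmem⟩
    omega
  obtain ⟨e', hsingle⟩ := Finset.card_eq_one.1 hone
  rw [hsingle] at hmem
  have hee : e = e' := by simpa using hmem
  subst hee
  let l := (Finset.univ.filter fun Y : Finset V => Tight x Y ∧ Y ⊆ U ∧ ¬ Inside Y e).toList
  have hl : ∀ Y, Y ∈ l ↔ Tight x Y ∧ Y ⊆ U ∧ ¬ Inside Y e := by intro Y; simp [l]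
  obtain ⟨m, hm⟩ := exists_int_sum_inside_list hx _ l rfl (fun Y hY => Or.inr ((hl Y).1 hY).1)
  have hsub : (Finset.univ.filter fun f => ∃ Y ∈ l, Inside Y f) ⊆
      (Finset.univ.filter (Inside U)) := by
    intro f hf
    simp only [Finset.mem_filter, Finset.mem_univ, true_and] at hf ⊢
    obtain ⟨Y, hY, hYf⟩ := hf
    exact hYf.mono ((hl Y).1 hY).2.1
  have hdiff := Finset.sum_sdiff (f := x) hsub
  have hUw : insideWeight x U = (U.card : ℝ) - 1 := (hull_tight hx hV e).2
  rw [insideWeight] at hUw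
  rw [hUw, ← hm, Finset.sum_eq_single_of_mem e] at hdiff
  · refine not_int_of_mem_fracEdges hx he ((U.card : ℤ) - 1 - m) ?_
    push_cast
    linarith
  · simp only [Finset.mem_sdiff, Finset.mem_filter, Finset.mem_univ, true_and]
    refine ⟨inside_hull hx hV e, ?_⟩
    rintro ⟨Y, hY, hYe⟩
    exact ((hl Y).1 hY).2.2 hYe
  · intro f hf hfe
    simp only [Finset.mem_sdiff, Finset.mem_filter, Finset.mem_univ, true_and] at hf
    by_contra hf0
    by_cases hf1 : x f = 1
    · have hfG : f ∈ G.edgeSet := by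
        by_contra h
        exact hf0 (hx.support f h)
      induction f using Sym2.ind with
      | _ a b =>
        have hab : a ≠ b := G.ne_of_adj (by simpa using hfG)
        refine hf.2 ⟨{a, b}, (hl _).2 ⟨tight_pair hx hab hf1, ?_, ?_⟩, by simp [inside_mk]⟩
        · have := inside_mk.1 hf.1
          intro v hv
          simp only [Finset.mem_insert, Finset.mem_singleton] at hv
          rcases hv with rfl | rfl
          · exact this.1
          · exact this.2
        · intro h
          have heG : e ∈ G.edgeSet := by
            by_contra h
            exact (Finset.mem_filter.1 he).2.1 (hx.support e h)
          induction e using Sym2.ind with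
          | _ c d =>
            have hcd : c ≠ d := G.ne_of_adj (by simpa using heG)
            rw [inside_mk] at h
            simp only [Finset.mem_insert, Finset.mem_singleton] at h
            apply hfe
            rw [Sym2.eq_iff]
            rcases h with ⟨rfl | rfl, rfl | rfl⟩ <;> simp_all
    · have hff : f ∈ fracEdges x := by simp [fracEdges, hf0, hf1]
      have hsubU : hull hx hV f ⊆ U := (hull_subset_iff hx hV (hull_tight hx hV e)).2 hf.1
      refine hf.2 ⟨hull hx hV f, (hl _).2 ⟨hull_tight hx hV f, hsubU, ?_⟩, inside_hull hx hV f⟩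
      intro h
      have := (hull_subset_iff hx hV (hull_tight hx hV f)).2 h
      have hfc : f ∈ hullClass hx hV U := by
        simp only [hullClass, Finset.mem_filter]
        exact ⟨hff, Finset.Subset.antisymm hsubU this⟩
      rw [hsingle] at hfc
      exact hfe (by simpa using hfc)

end Uncrossing

/-- Distinct members of the family are disjoint. -/
def DisjointFamily (𝒮 : Finset (Finset V)) : Prop :=
  ∀ S ∈ 𝒮, ∀ T ∈ 𝒮, S ≠ T → Disjoint S T

/-- The edge `e` touches two distinct members of `𝒮`. -/
def Joins (𝒮 : Finset (Finset V)) (e : Sym2 V) : Prop :=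
  ∃ S ∈ 𝒮, ∃ T ∈ 𝒮, S ≠ T ∧ Touches S e ∧ Touches T e

lemma inside_union_of_touches {S T : Finset V} (h : Disjoint S T) {e : Sym2 V}
    (hS : Touches S e) (hT : Touches T e) : Inside (S ∪ T) e := by
  induction e using Sym2.ind with
  | _ a b =>
    rw [touches_mk] at hS hT
    rw [inside_mk, Finset.mem_union, Finset.mem_union]
    rcases hS with hS | hS <;> rcases hT with hT | hT
    · exact absurd hT (Finset.disjoint_left.1 h hS)
    · exact ⟨Or.inl hS, Or.inr hT⟩
    · exact ⟨Or.inr hT, Or.inl hS⟩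
    · exact absurd hT (Finset.disjoint_left.1 h hS)

lemma not_inside_of_touches_disjoint {S T : Finset V} (h : Disjoint S T) {e : Sym2 V}
    (hT : Touches T e) : ¬ Inside S e := by
  obtain ⟨v, hv, hvT⟩ := hT
  exact fun hS => Finset.disjoint_left.1 h (hS v hv) hvT

lemma card_filter_touches_le_two {𝒮 : Finset (Finset V)} (h : DisjointFamily 𝒮) (e : Sym2 V) :
    (𝒮.filter fun S => Touches S e).card ≤ 2 := by
  induction e using Sym2.ind with
  | _ a b =>
    have h1 : ∀ v, (𝒮.filter fun S => v ∈ S).card ≤ 1 := by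
      intro v
      rw [Finset.card_le_one]
      intro S hS T hT
      by_contra hne
      rw [Finset.mem_filter] at hS hT
      exact Finset.disjoint_left.1 (h S hS.1 T hT.1 hne) hS.2 hT.2
    have h2 : (𝒮.filter fun S => Touches S s(a, b)) ⊆
        (𝒮.filter fun S => a ∈ S) ∪ 𝒮.filter fun S => b ∈ S := by
      intro S hS
      simpa [touches_mk, ← and_or_left] using hS
    have h3 := (Finset.card_le_card h2).trans (Finset.card_union_le _ _)
    have := h1 a
    have := h1 b
    omega

lemma card_filter_touches_le_one {𝒮 : Finset (Finset V)} {e : Sym2 V} (h : ¬ Joins 𝒮 e) :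
    (𝒮.filter fun S => Touches S e).card ≤ 1 := by
  rw [Finset.card_le_one]
  intro S hS T hT
  by_contra hne
  rw [Finset.mem_filter] at hS hT
  exact h ⟨S, hS.1, T, hT.1, hne, hS.2, hT.2⟩

/-- Members of a family of finite sets are pairwise disjoint or nested. -/
def LaminarFamily (𝒯 : Finset (Finset V)) : Prop :=
  ∀ S ∈ 𝒯, ∀ T ∈ 𝒯, Disjoint S T ∨ S ⊆ T ∨ T ⊆ S

/-- No member of `𝒯` properly contains `S`. -/
def MaximalIn (𝒯 : Finset (Finset V)) (S : Finset V) : Prop := ∀ T ∈ 𝒯, S ⊆ T → S = T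

/-- The inclusionwise maximal members. -/
def roots (𝒯 : Finset (Finset V)) : Finset (Finset V) := 𝒯.filter (MaximalIn 𝒯)

lemma exists_root (𝒯 : Finset (Finset V)) {S : Finset V} (hS : S ∈ 𝒯) :
    ∃ R ∈ roots 𝒯, S ⊆ R := by
  obtain ⟨R, hR, hmax⟩ := Finset.exists_max_image (𝒯.filter fun R => S ⊆ R) Finset.card
    ⟨S, Finset.mem_filter.2 ⟨hS, subset_rfl⟩⟩
  obtain ⟨hR𝒯, hSR⟩ := Finset.mem_filter.1 hR
  exact ⟨R, Finset.mem_filter.2 ⟨hR𝒯, fun T hT hRT => Finset.eq_of_subset_of_card_le hRT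
    (hmax T (Finset.mem_filter.2 ⟨hT, hSR.trans hRT⟩))⟩, hSR⟩

lemma LaminarFamily.disjointFamily_roots {𝒯 : Finset (Finset V)} (h : LaminarFamily 𝒯) :
    DisjointFamily (roots 𝒯) := by
  intro S hS T hT hne
  obtain ⟨hS1, hS2⟩ := Finset.mem_filter.1 hS
  obtain ⟨hT1, hT2⟩ := Finset.mem_filter.1 hT
  rcases h S hS1 T hT1 with h | h | h
  · exact h
  · exact absurd (hS2 T hT1 h) hne
  · exact absurd (hT2 S hS1 h).symm hne

lemma LaminarFamily.mono {𝒯 𝒯' : Finset (Finset V)} (h : LaminarFamily 𝒯) (hs : 𝒯' ⊆ 𝒯) :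
    LaminarFamily 𝒯' := fun S hS T hT => h S (hs hS) T (hs hT)

/-- The edge `e` lies inside `X` but inside no member of `𝒮`. -/
def Separated (X : Finset V) (𝒮 : Finset (Finset V)) (e : Sym2 V) : Prop :=
  Inside X e ∧ ∀ S ∈ 𝒮, ¬ Inside S e

/-- Total cut size of disjoint subsets of `X` in terms of the edges separated by them. -/
lemma sum_card_crosses_le (F : Finset (Sym2 V)) {X : Finset V} {𝒮 : Finset (Finset V)}
    (hdisj : DisjointFamily 𝒮) (hsub : ∀ S ∈ 𝒮, S ⊆ X) :
    ∑ S ∈ 𝒮, (F.filter (Crosses S)).card ≤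
      ∑ e ∈ F.filter (Separated X 𝒮), (𝒮.filter fun S => Touches S e).card +
        (F.filter (Crosses X)).card := by
  have hdc : ∑ S ∈ 𝒮, (F.filter (Crosses S)).card =
      ∑ e ∈ F, (𝒮.filter fun S => Crosses S e).card :=
    Finset.sum_card_bipartiteAbove_eq_sum_card_bipartiteBelow Crosses
  have hct : ∀ e, (𝒮.filter fun S => Crosses S e).card ≤
      (𝒮.filter fun S => Touches S e).card := fun e =>
    Finset.card_le_card (Finset.monotone_filter_right _ fun S _ hS => hS.1)
  rw [hdc, Finset.sum_filter, Finset.card_filter, ← Finset.sum_add_distrib]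
  refine Finset.sum_le_sum fun e _ => ?_
  by_cases hin : Inside X e
  · by_cases hS : ∃ S ∈ 𝒮, Inside S e
    · obtain ⟨S, hS, hSe⟩ := hS
      have h0 : (𝒮.filter fun S => Crosses S e).card = 0 := by
        refine Finset.card_eq_zero.2 (Finset.filter_eq_empty_iff.2 fun T hT hcr => ?_)
        by_cases hTS : S = T
        · exact hcr.2 (hTS ▸ hSe)
        · exact not_inside_of_touches_disjoint (hdisj S hS T hT hTS) hcr.1 hSe
      rw [h0]
      exact Nat.zero_le _
    · push Not at hS
      rw [if_pos ⟨hin, hS⟩]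
      exact (hct e).trans (Nat.le_add_right _ _)
  · rw [if_neg fun h => hin h.1, zero_add]
    by_cases ht : Touches X e
    · rw [if_pos ⟨ht, hin⟩]
      refine (hct e).trans (card_filter_touches_le_one ?_)
      rintro ⟨S, hS, T, hT, hST, hSe, hTe⟩
      exact hin ((inside_union_of_touches (hdisj S hS T hT hST) hSe hTe).mono
        (Finset.union_subset (hsub S hS) (hsub T hT)))
    · have h0 : (𝒮.filter fun S => Crosses S e).card = 0 :=
        Finset.card_eq_zero.2 (Finset.filter_eq_empty_iff.2 fun T hT hcr =>
          ht (hcr.1.mono (hsub T hT)))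
      rw [h0]
      exact Nat.zero_le _

section Counting

variable [Fintype V] {G : SimpleGraph V} {x : Sym2 V → ℝ}

lemma Tight.union_family (hx : IsSubtour G x) {U : Finset V} (hU : Tight x U)
    (M : Finset (Finset V)) (hM : ∀ S ∈ M, Tight x S ∧ (S ∩ U).Nonempty) :
    Tight x (U ∪ M.biUnion id) ∧
      ∀ e, x e ≠ 0 → Inside (U ∪ M.biUnion id) e → Inside U e ∨ ∃ S ∈ M, Inside S e := by
  induction M using Finset.induction_on with
  | empty =>
    rw [Finset.biUnion_empty, Finset.union_empty]
    exact ⟨hU, fun e _ h => Or.inl h⟩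
  | insert S M hS ih =>
    obtain ⟨ih1, ih2⟩ := ih fun T hT => hM T (Finset.mem_insert_of_mem hT)
    obtain ⟨hSt, hSU⟩ := hM S (Finset.mem_insert_self _ _)
    have heq : U ∪ (insert S M).biUnion id = S ∪ (U ∪ M.biUnion id) := by
      rw [Finset.biUnion_insert, id, Finset.union_left_comm]
    have hun := hSt.uncross hx ih1
      (hSU.mono (Finset.inter_subset_inter_left Finset.subset_union_left))
    rw [heq]
    refine ⟨hun.2.1, fun e he hin => ?_⟩
    rcases hun.2.2 e he hin with h | h
    · exact Or.inr ⟨S, Finset.mem_insert_self _ _, h⟩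
    · rcases ih2 e he h with h | ⟨T, hT, h⟩
      · exact Or.inl h
      · exact Or.inr ⟨T, Finset.mem_insert_of_mem hT, h⟩

lemma ne_zero_of_mem_fracEdges {e : Sym2 V} (he : e ∈ fracEdges x) : x e ≠ 0 :=
  (Finset.mem_filter.1 he).2.1

/-- The edges joining `n` disjoint tight sets have at most `n - 1` different hulls. -/
lemma card_hull_joins_lt (hx : IsSubtour G x) (hV : Tight x Finset.univ) (n : ℕ) :
    ∀ 𝒮 : Finset (Finset V), 𝒮.card = n → 𝒮.Nonempty → DisjointFamily 𝒮 →
      (∀ S ∈ 𝒮, Tight x S) →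
      (((fracEdges x).filter (Joins 𝒮)).image (hull hx hV)).card + 1 ≤ 𝒮.card := by
  induction n using Nat.strong_induction_on with
  | _ n ih =>
    intro 𝒮 hcard hne hdisj htight
    by_cases hempty : ((fracEdges x).filter (Joins 𝒮)).Nonempty
    · obtain ⟨e, he, hmin⟩ := Finset.exists_min_image _ (fun e => (hull hx hV e).card) hempty
      obtain ⟨heF, A, hA, B, hB, hAB, hAe, hBe⟩ := Finset.mem_filter.1 he
      set U := hull hx hV e with hU
      have hUt : Tight x U := hull_tight hx hV e
      have hUe : Inside U e := inside_hull hx hV e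
      set M := 𝒮.filter fun S => (S ∩ U).Nonempty with hM
      have hmeet : ∀ S, Touches S e → (S ∩ U).Nonempty := by
        rintro S ⟨v, hv, hvS⟩
        exact ⟨v, Finset.mem_inter.2 ⟨hvS, hUe v hv⟩⟩
      have hAM : A ∈ M := Finset.mem_filter.2 ⟨hA, hmeet A hAe⟩
      have hBM : B ∈ M := Finset.mem_filter.2 ⟨hB, hmeet B hBe⟩
      obtain ⟨hYt, hYe⟩ := hUt.union_family hx M fun S hS =>
        ⟨htight S (Finset.mem_filter.1 hS).1, (Finset.mem_filter.1 hS).2⟩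
      set Y := U ∪ M.biUnion id with hY
      have hMY : ∀ S ∈ M, S ⊆ Y := fun S hS =>
        (Finset.subset_biUnion_of_mem id hS).trans Finset.subset_union_right
      have hYdisj : ∀ T ∈ 𝒮 \ M, Disjoint Y T := by
        intro T hT
        obtain ⟨hT𝒮, hTM⟩ := Finset.mem_sdiff.1 hT
        rw [hY, Finset.disjoint_union_left, Finset.disjoint_biUnion_left]
        refine ⟨?_, fun S hS => hdisj S (Finset.mem_filter.1 hS).1 T hT𝒮 ?_⟩
        · rw [disjoint_comm, Finset.disjoint_iff_inter_eq_empty, ← Finset.not_nonempty_iff_eq_empty]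
          exact fun h => hTM (Finset.mem_filter.2 ⟨hT𝒮, h⟩)
        · rintro rfl
          exact hTM hS
      have hsub : M ⊆ 𝒮 := Finset.filter_subset _ _
      have hM2 : 2 ≤ M.card := by
        rw [← Finset.card_pair hAB]
        exact Finset.card_le_card (by simp [Finset.insert_subset_iff, hAM, hBM])
      have hcard' : (insert Y (𝒮 \ M)).card + 1 ≤ 𝒮.card := by
        have h1 := Finset.card_insert_le Y (𝒮 \ M)
        have h2 := Finset.card_sdiff_add_card_eq_card hsub
        omega
      have hih := ih _ (by omega) (insert Y (𝒮 \ M)) rfl (Finset.insert_nonempty _ _) (by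
        intro S hS T hT hST
        rcases Finset.mem_insert.1 hS with rfl | hS' <;> rcases Finset.mem_insert.1 hT with rfl | hT'
        · exact absurd rfl hST
        · exact hYdisj T hT'
        · exact (hYdisj S hS').symm
        · exact hdisj S (Finset.mem_sdiff.1 hS').1 T (Finset.mem_sdiff.1 hT').1 hST) (by
        intro S hS
        rcases Finset.mem_insert.1 hS with rfl | hS'
        · exact hYt
        · exact htight S (Finset.mem_sdiff.1 hS').1)
      have hQ : ((fracEdges x).filter (Joins 𝒮)).image (hull hx hV) ⊆
          insert U (((fracEdges x).filter (Joins (insert Y (𝒮 \ M)))).image (hull hx hV)) := by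
        intro W hW
        obtain ⟨f, hf, rfl⟩ := Finset.mem_image.1 hW
        obtain ⟨hfF, S, hS, T, hT, hST, hSf, hTf⟩ := Finset.mem_filter.1 hf
        have key : ∀ S ∈ 𝒮, ∀ T ∈ 𝒮, Touches S f → Touches T f → S ∈ M → T ∉ M →
            Joins (insert Y (𝒮 \ M)) f := by
          intro S hS T hT hSf hTf hSM hTM
          have hT' : T ∈ 𝒮 \ M := Finset.mem_sdiff.2 ⟨hT, hTM⟩
          refine ⟨Y, Finset.mem_insert_self _ _, T, Finset.mem_insert_of_mem hT', ?_,
            hSf.mono (hMY S hSM), hTf⟩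
          intro h
          have := hYdisj T hT'
          rw [h, disjoint_self] at this
          obtain ⟨v, hv⟩ := (htight T hT).1
          rw [this] at hv
          simp at hv
        by_cases hj : Joins (insert Y (𝒮 \ M)) f
        · exact Finset.mem_insert_of_mem
            (Finset.mem_image_of_mem _ (Finset.mem_filter.2 ⟨hfF, hj⟩))
        · have hSM : S ∈ M ∧ T ∈ M := by
            by_cases h1 : S ∈ M <;> by_cases h2 : T ∈ M
            · exact ⟨h1, h2⟩
            · exact absurd (key S hS T hT hSf hTf h1 h2) hj
            · exact absurd (key T hT S hS hTf hSf h2 h1) hj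
            · exact absurd ⟨S, Finset.mem_insert_of_mem (Finset.mem_sdiff.2 ⟨hS, h1⟩), T,
                Finset.mem_insert_of_mem (Finset.mem_sdiff.2 ⟨hT, h2⟩), hST, hSf, hTf⟩ hj
          have hfY : Inside Y f := (inside_union_of_touches (hdisj S hS T hT hST) hSf hTf).mono
            (Finset.union_subset (hMY S hSM.1) (hMY T hSM.2))
          rcases hYe f (ne_zero_of_mem_fracEdges hfF) hfY with h | ⟨R, hR, h⟩
          · have h1 := (hull_subset_iff hx hV hUt).2 h
            rw [Finset.eq_of_subset_of_card_le h1 (hmin f hf)]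
            exact Finset.mem_insert_self _ _
          · exfalso
            have hRS : R = S := by
              by_contra hne
              exact not_inside_of_touches_disjoint
                (hdisj R (hsub hR) S hS hne) hSf h
            have hRT : R = T := by
              by_contra hne
              exact not_inside_of_touches_disjoint
                (hdisj R (hsub hR) T hT hne) hTf h
            exact hST (hRS.symm.trans hRT)
      have h1 := Finset.card_le_card hQ
      have h2 := Finset.card_insert_le U
        (((fracEdges x).filter (Joins (insert Y (𝒮 \ M)))).image (hull hx hV))
      omega
    · rw [Finset.not_nonempty_iff_eq_empty] at hempty
      rw [hempty]
      simpa using hne.card_pos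

/-- The number of fractional edges crossing `S`. -/
def fracCut (x : Sym2 V → ℝ) (S : Finset V) : ℕ := ((fracEdges x).filter (Crosses S)).card

/-- The hulls of the fractional edges. -/
def hulls (hx : IsSubtour G x) (hV : Tight x Finset.univ) : Finset (Finset V) :=
  (fracEdges x).image (hull hx hV)

/-- The total excess `|class| - 1` of the classes in a family of hulls. -/
def excess (hx : IsSubtour G x) (hV : Tight x Finset.univ) (𝒲 : Finset (Finset V)) : ℤ :=
  ∑ U ∈ 𝒲, (((hullClass hx hV U).card : ℤ) - 1)

/-- The hulls within `X` contained in no member of `𝒮`. -/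
def hullsBetween (hx : IsSubtour G x) (hV : Tight x Finset.univ) (X : Finset V)
    (𝒮 : Finset (Finset V)) : Finset (Finset V) :=
  (hulls hx hV).filter fun U => U ⊆ X ∧ ∀ S ∈ 𝒮, ¬ U ⊆ S

lemma two_le_card_of_mem_hulls (hx : IsSubtour G x) (hV : Tight x Finset.univ) {U : Finset V}
    (hU : U ∈ hulls hx hV) : 2 ≤ (hullClass hx hV U).card := by
  obtain ⟨e, he, rfl⟩ := Finset.mem_image.1 hU
  exact two_le_card_hullClass hx hV he

lemma excess_nonneg (hx : IsSubtour G x) (hV : Tight x Finset.univ) {𝒲 : Finset (Finset V)}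
    (h : 𝒲 ⊆ hulls hx hV) : 0 ≤ excess hx hV 𝒲 :=
  Finset.sum_nonneg fun U hU => by
    have := two_le_card_of_mem_hulls hx hV (h hU)
    omega

lemma excess_add_le (hx : IsSubtour G x) (hV : Tight x Finset.univ)
    {𝒲₁ 𝒲₂ 𝒲 : Finset (Finset V)} (h : 𝒲 ⊆ hulls hx hV) (h1 : 𝒲₁ ⊆ 𝒲) (h2 : 𝒲₂ ⊆ 𝒲)
    (hd : Disjoint 𝒲₁ 𝒲₂) : excess hx hV 𝒲₁ + excess hx hV 𝒲₂ ≤ excess hx hV 𝒲 := by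
  rw [excess, excess, ← Finset.sum_union hd]
  refine Finset.sum_le_sum_of_subset_of_nonneg (Finset.union_subset h1 h2) fun U hU _ => ?_
  have := two_le_card_of_mem_hulls hx hV (h hU)
  omega

/-- The fractional edges inside `X` and inside no member of `𝒮` are partitioned into classes. -/
lemma filter_between_eq (hx : IsSubtour G x) (hV : Tight x Finset.univ) {X : Finset V}
    (hX : Tight x X) {𝒮 : Finset (Finset V)} (h𝒮 : ∀ S ∈ 𝒮, Tight x S) (U : Finset V)
    (hU : U ∈ hullsBetween hx hV X 𝒮) :
    (((fracEdges x).filter (Separated X 𝒮)).filter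
      fun e => hull hx hV e = U) = hullClass hx hV U := by
  obtain ⟨-, hUX, hUS⟩ := Finset.mem_filter.1 hU
  ext e
  simp only [hullClass, Finset.mem_filter]
  constructor
  · rintro ⟨⟨h, -⟩, h'⟩
    exact ⟨h, h'⟩
  · rintro ⟨h, rfl⟩
    exact ⟨⟨h, (hull_subset_iff hx hV hX).1 hUX, fun S hS hin =>
      hUS S hS ((hull_subset_iff hx hV (h𝒮 S hS)).2 hin)⟩, rfl⟩

lemma sum_between {M : Type*} [AddCommMonoid M] (hx : IsSubtour G x) (hV : Tight x Finset.univ) {X : Finset V}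
    (hX : Tight x X) {𝒮 : Finset (Finset V)} (h𝒮 : ∀ S ∈ 𝒮, Tight x S) (f : Sym2 V → M) :
    ∑ e ∈ (fracEdges x).filter (Separated X 𝒮), f e =
      ∑ U ∈ hullsBetween hx hV X 𝒮, ∑ e ∈ hullClass hx hV U, f e := by
  rw [← Finset.sum_fiberwise_of_maps_to (g := hull hx hV) (t := hullsBetween hx hV X 𝒮)]
  · exact Finset.sum_congr rfl fun U hU => by rw [filter_between_eq hx hV hX h𝒮 U hU]
  · intro e he
    obtain ⟨heF, heX, heS⟩ := Finset.mem_filter.1 he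
    refine Finset.mem_filter.2 ⟨Finset.mem_image_of_mem _ heF,
      (hull_subset_iff hx hV hX).2 heX, fun S hS h => heS S hS ?_⟩
    exact (hull_subset_iff hx hV (h𝒮 S hS)).1 h

lemma sum_fracCut_le (hx : IsSubtour G x) (hV : Tight x Finset.univ) {X : Finset V}
    (hX : Tight x X) {𝒮 : Finset (Finset V)} (hne : 𝒮.Nonempty) (hdisj : DisjointFamily 𝒮)
    (h𝒮 : ∀ S ∈ 𝒮, Tight x S ∧ S ⊆ X) :
    ∑ S ∈ 𝒮, (fracCut x S : ℤ) ≤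
      2 * excess hx hV (hullsBetween hx hV X 𝒮) + 2 * ((𝒮.card : ℤ) - 1) + fracCut x X := by
  set c : Sym2 V → ℤ := fun e => ((𝒮.filter fun S => Touches S e).card : ℤ) with hc
  set A := (fracEdges x).filter (Separated X 𝒮) with hA
  have hsplit : ∑ S ∈ 𝒮, (fracCut x S : ℤ) ≤ ∑ e ∈ A, c e + fracCut x X := by
    have := sum_card_crosses_le (fracEdges x) hdisj fun S hS => (h𝒮 S hS).2
    simp only [hc, fracCut]
    exact_mod_cast this
  set Q := ((fracEdges x).filter (Joins 𝒮)).image (hull hx hV) with hQ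
  have hJ : Q.card + 1 ≤ 𝒮.card :=
    card_hull_joins_lt hx hV _ 𝒮 rfl hne hdisj fun S hS => (h𝒮 S hS).1
  have hAsum := sum_between hx hV hX (fun S hS => (h𝒮 S hS).1) c
  rw [← hA] at hAsum
  have hclass : ∀ U ∈ hullsBetween hx hV X 𝒮, ∑ e ∈ hullClass hx hV U, c e ≤
      2 * (((hullClass hx hV U).card : ℤ) - 1) + 2 * (if U ∈ Q then 1 else 0) := by
    intro U hU
    by_cases hUQ : U ∈ Q
    · rw [if_pos hUQ]
      have := Finset.sum_le_card_nsmul (hullClass hx hV U) c 2 fun e _ => by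
        simp only [hc]
        exact_mod_cast card_filter_touches_le_two hdisj e
      rw [nsmul_eq_mul] at this
      linarith
    · rw [if_neg hUQ]
      have := Finset.sum_le_card_nsmul (hullClass hx hV U) c 1 fun e he => by
        have : ¬ Joins 𝒮 e := by
          intro hj
          obtain ⟨heF, rfl⟩ := Finset.mem_filter.1 he
          exact hUQ (Finset.mem_image_of_mem _ (Finset.mem_filter.2 ⟨heF, hj⟩))
        simp only [hc]
        exact_mod_cast card_filter_touches_le_one this
      rw [nsmul_eq_mul] at this
      have h2 := two_le_card_of_mem_hulls hx hV (Finset.mem_filter.1 hU).1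
      have h2' : (2 : ℤ) ≤ (hullClass hx hV U).card := by exact_mod_cast h2
      linarith
  have h3 := Finset.sum_le_sum hclass
  rw [Finset.sum_add_distrib, ← Finset.mul_sum, ← Finset.mul_sum] at h3
  have h4 : (∑ U ∈ hullsBetween hx hV X 𝒮, if U ∈ Q then (1 : ℤ) else 0) ≤ Q.card := by
    rw [Finset.sum_boole]
    refine Int.ofNat_le.2 (Finset.card_le_card fun U hU => (Finset.mem_filter.1 hU).2)
  have h5 : (Q.card : ℤ) + 1 ≤ 𝒮.card := by exact_mod_cast hJ
  rw [excess]
  linarith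

/-- The fractional edges touching `S`. -/
def fracTouch (x : Sym2 V → ℝ) (S : Finset V) : Finset (Sym2 V) :=
  (fracEdges x).filter (Touches S)

lemma fracCut_add_le (hx : IsSubtour G x) (hV : Tight x Finset.univ) {X C : Finset V}
    (hX : Tight x X) (hC : Tight x C) (hCX : C ⊆ X) :
    (fracCut x C : ℤ) + (fracTouch x X \ fracTouch x C).card ≤
      2 * excess hx hV (hullsBetween hx hV X {C}) + fracCut x X := by
  set A := (fracEdges x).filter (Separated X {C}) with hA
  have hAsum := sum_between hx hV hX (𝒮 := {C}) (by simpa using hC) (fun _ => (1 : ℤ))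
  rw [← hA] at hAsum
  have hAle : (A.card : ℤ) ≤ 2 * excess hx hV (hullsBetween hx hV X {C}) := by
    have h1 : (A.card : ℤ) = ∑ U ∈ hullsBetween hx hV X {C}, ((hullClass hx hV U).card : ℤ) := by
      simpa using hAsum
    rw [h1, excess, Finset.mul_sum]
    refine Finset.sum_le_sum fun U hU => ?_
    have h2 := two_le_card_of_mem_hulls hx hV (Finset.mem_filter.1 hU).1
    omega
  have hd : Disjoint ((fracEdges x).filter (Crosses C)) (fracTouch x X \ fracTouch x C) := by
    rw [Finset.disjoint_left]
    intro e he he'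
    obtain ⟨h1, h2⟩ := Finset.mem_filter.1 he
    exact (Finset.mem_sdiff.1 he').2 (Finset.mem_filter.2 ⟨h1, h2.1⟩)
  have hsub : (fracEdges x).filter (Crosses C) ∪ (fracTouch x X \ fracTouch x C) ⊆
      A ∪ (fracEdges x).filter (Crosses X) := by
    intro e he
    have h : e ∈ fracEdges x ∧ Touches X e ∧ ¬ Inside C e := by
      rcases Finset.mem_union.1 he with he | he
      · obtain ⟨h1, h2⟩ := Finset.mem_filter.1 he
        exact ⟨h1, h2.1.mono hCX, h2.2⟩
      · obtain ⟨h1, h2⟩ := Finset.mem_sdiff.1 he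
        obtain ⟨h3, h4⟩ := Finset.mem_filter.1 h1
        exact ⟨h3, h4, fun h => h2 (Finset.mem_filter.2 ⟨h3, h.touches⟩)⟩
    rw [Finset.mem_union]
    by_cases hin : Inside X e
    · exact Or.inl (Finset.mem_filter.2 ⟨h.1, hin, by simpa using h.2.2⟩)
    · exact Or.inr (Finset.mem_filter.2 ⟨h.1, h.2.1, hin⟩)
  have h1 := (Finset.card_le_card hsub).trans (Finset.card_union_le _ _)
  rw [Finset.card_union_of_disjoint hd] at h1
  simp only [fracCut]
  have h2 : ((((fracEdges x).filter (Crosses C)).card : ℤ) +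
    (fracTouch x X \ fracTouch x C).card) ≤ A.card + ((fracEdges x).filter (Crosses X)).card := by
    exact_mod_cast h1
  linarith

/-- The hulls contained in some member of `𝒯`. -/
def hullsWithin (hx : IsSubtour G x) (hV : Tight x Finset.univ)
    (𝒯 : Finset (Finset V)) : Finset (Finset V) :=
  (hulls hx hV).filter fun U => ∃ S ∈ 𝒯, U ⊆ S

/-- The token-counting invariant of a laminar family of tight sets. -/
lemma two_card_le_excess (hx : IsSubtour G x) (hV : Tight x Finset.univ) (n : ℕ) :
    ∀ 𝒯 : Finset (Finset V), 𝒯.card = n → LaminarFamily 𝒯 → (∀ S ∈ 𝒯, Tight x S) →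
      (∀ S ∈ 𝒯, 6 ≤ fracCut x S) →
      (∀ S ∈ 𝒯, ∀ C ∈ 𝒯, C ⊂ S → 2 ≤ (fracTouch x S \ fracTouch x C).card) →
      2 * (𝒯.card : ℤ) ≤ 2 * excess hx hV (hullsWithin hx hV 𝒯) +
        ∑ R ∈ roots 𝒯, ((fracCut x R : ℤ) - 4) := by
  induction n with
  | zero =>
    intro 𝒯 hcard _ _ _ _
    rw [Finset.card_eq_zero] at hcard
    subst hcard
    simp [hullsWithin, excess, roots]
  | succ n ih =>
    intro 𝒯 hcard hlam htight hsix hgap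
    obtain ⟨S, hS, hmax⟩ := Finset.exists_max_image 𝒯 Finset.card
      (Finset.card_pos.1 (by omega))
    have hSmax : ∀ T ∈ 𝒯, S ⊆ T → S = T := fun T hT h =>
      Finset.eq_of_subset_of_card_le h (hmax T hT)
    set 𝒯' := 𝒯.erase S with h𝒯'
    have hsub : 𝒯' ⊆ 𝒯 := Finset.erase_subset _ _
    have hcard' : 𝒯'.card = n := by rw [h𝒯', Finset.card_erase_of_mem hS, hcard]; rfl
    have hih := ih 𝒯' hcard' (hlam.mono hsub) (fun T hT => htight T (hsub hT))
      (fun T hT => hsix T (hsub hT)) (fun T hT C hC => hgap T (hsub hT) C (hsub hC))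
    have hcase : ∀ T ∈ 𝒯', (T ∩ S).Nonempty → T ⊆ S := by
      intro T hT hne
      rcases hlam T (hsub hT) S hS with h | h | h
      · rw [Finset.disjoint_iff_inter_eq_empty] at h
        exact absurd h hne.ne_empty
      · exact h
      · exact (hSmax T (hsub hT) h).ge
    have hSr : S ∈ roots 𝒯 := Finset.mem_filter.2 ⟨hS, hSmax⟩
    set K := (roots 𝒯').filter (· ⊆ S) with hK
    set O := (roots 𝒯').filter (fun T => ¬ T ⊆ S) with hO
    have hKmem : ∀ C ∈ K, C ∈ 𝒯' ∧ C ⊆ S := fun C hC =>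
      ⟨(Finset.mem_filter.1 (Finset.mem_filter.1 hC).1).1, (Finset.mem_filter.1 hC).2⟩
    have hsumK : ∑ R ∈ roots 𝒯', ((fracCut x R : ℤ) - 4) =
        ∑ R ∈ K, ((fracCut x R : ℤ) - 4) + ∑ R ∈ O, ((fracCut x R : ℤ) - 4) :=
      (Finset.sum_filter_add_sum_filter_not _ _ _).symm
    have hroots : roots 𝒯 = insert S O := by
      ext T
      rw [Finset.mem_insert]
      constructor
      · intro hT
        by_cases hTS : T = S
        · exact Or.inl hTS
        · obtain ⟨hT1, hT2⟩ := Finset.mem_filter.1 hT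
          refine Or.inr (Finset.mem_filter.2 ⟨Finset.mem_filter.2
            ⟨Finset.mem_erase.2 ⟨hTS, hT1⟩, fun R hR => hT2 R (hsub hR)⟩, fun h => hTS (hT2 S hS h)⟩)
      · rintro (rfl | hT)
        · exact hSr
        · obtain ⟨hT1, hT2⟩ := Finset.mem_filter.1 hT
          obtain ⟨hT3, hT4⟩ := Finset.mem_filter.1 hT1
          refine Finset.mem_filter.2 ⟨hsub hT3, fun R hR hTR => ?_⟩
          by_cases hRS : R = S
          · exact absurd (hRS ▸ hTR) hT2
          · exact hT4 R (Finset.mem_erase.2 ⟨hRS, hR⟩) hTR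
    have hSO : S ∉ O := fun h => (Finset.mem_filter.1 h).2 subset_rfl
    rw [hroots, Finset.sum_insert hSO]
    have hexc : excess hx hV (hullsWithin hx hV 𝒯') + excess hx hV (hullsBetween hx hV S K) ≤
        excess hx hV (hullsWithin hx hV 𝒯) := by
      refine excess_add_le hx hV (Finset.filter_subset _ _) ?_ ?_ ?_
      · exact Finset.monotone_filter_right _ fun U _ ⟨T, hT, hUT⟩ => ⟨T, hsub hT, hUT⟩
      · exact Finset.monotone_filter_right _ fun U _ hU => ⟨S, hS, hU.1⟩
      · rw [Finset.disjoint_left]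
        intro U hU hU'
        obtain ⟨hU1, T, hT, hUT⟩ := Finset.mem_filter.1 hU
        obtain ⟨-, hUS, hUK⟩ := Finset.mem_filter.1 hU'
        obtain ⟨R, hR, hTR⟩ := exists_root 𝒯' hT
        obtain ⟨e, -, rfl⟩ := Finset.mem_image.1 hU1
        obtain ⟨v, hv⟩ := (hull_tight hx hV e).1
        refine hUK R (Finset.mem_filter.2 ⟨hR, ?_⟩) (hUT.trans hTR)
        exact hcase R (Finset.mem_filter.1 hR).1 ⟨v, Finset.mem_inter.2 ⟨hTR (hUT hv), hUS hv⟩⟩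
    have hnon : 0 ≤ excess hx hV (hullsBetween hx hV S K) :=
      excess_nonneg hx hV (Finset.filter_subset _ _)
    have hmain : 2 + ∑ R ∈ K, ((fracCut x R : ℤ) - 4) ≤
        2 * excess hx hV (hullsBetween hx hV S K) + ((fracCut x S : ℤ) - 4) := by
      rcases Nat.lt_or_ge K.card 2 with hlt | hge
      · rcases Nat.lt_or_ge K.card 1 with h0 | h1
        · have h0 : K = ∅ := Finset.card_eq_zero.1 (by omega)
          have := hsix S hS
          have h6 : (6 : ℤ) ≤ fracCut x S := by exact_mod_cast this
          rw [h0] at hnon ⊢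
          rw [Finset.sum_empty]
          linarith
        · obtain ⟨C, hC⟩ := Finset.card_eq_one.1 (show K.card = 1 by omega)
          obtain ⟨hC1, hC2⟩ := hKmem C (by rw [hC]; simp)
          have hne : C ≠ S := (Finset.mem_erase.1 hC1).1
          have h1 := fracCut_add_le hx hV (htight S hS) (htight C (hsub hC1)) hC2
          have h2 := hgap S hS C (hsub hC1) (hC2.ssubset_of_ne hne)
          have h2' : (2 : ℤ) ≤ (fracTouch x S \ fracTouch x C).card := by exact_mod_cast h2
          rw [hC, Finset.sum_singleton]
          linarith
      · have h1 := sum_fracCut_le hx hV (htight S hS) (𝒮 := K)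
          (Finset.card_pos.1 (by omega))
          (fun A hA B hB => (hlam.mono hsub).disjointFamily_roots A (Finset.mem_filter.1 hA).1
            B (Finset.mem_filter.1 hB).1)
          (fun C hC => ⟨htight C (hsub (hKmem C hC).1), (hKmem C hC).2⟩)
        have h2 : (2 : ℤ) ≤ K.card := by exact_mod_cast hge
        rw [Finset.sum_sub_distrib, Finset.sum_const, nsmul_eq_mul]
        linarith
    have hc1 : (𝒯.card : ℤ) = 𝒯'.card + 1 := by rw [hcard, hcard']; push_cast; ring
    linarith

/-- A laminar family of tight sets of large fractional degree is smaller than the total excess. -/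
lemma card_lt_excess (hx : IsSubtour G x) (hV : Tight x Finset.univ)
    (hF : (fracEdges x).Nonempty) (𝒯 : Finset (Finset V)) (hlam : LaminarFamily 𝒯)
    (htight : ∀ S ∈ 𝒯, Tight x S) (hsix : ∀ S ∈ 𝒯, 6 ≤ fracCut x S)
    (hgap : ∀ S ∈ 𝒯, ∀ C ∈ 𝒯, C ⊂ S → 2 ≤ (fracTouch x S \ fracTouch x C).card) :
    𝒯.card + (hulls hx hV).card < (fracEdges x).card := by
  have hcardF : ((fracEdges x).card : ℤ) = excess hx hV (hulls hx hV) + (hulls hx hV).card := by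
    rw [Finset.card_eq_sum_card_image (hull hx hV), excess, Finset.sum_sub_distrib]
    push_cast
    simp [hulls, hullClass]
  suffices h : (𝒯.card : ℤ) < excess hx hV (hulls hx hV) by omega
  rcases 𝒯.eq_empty_or_nonempty with rfl | hne
  · obtain ⟨e, he⟩ := hF
    have h1 := Finset.single_le_sum (f := fun U => ((hullClass hx hV U).card : ℤ) - 1)
      (fun U hU => by
        have := two_le_card_of_mem_hulls hx hV hU
        change (0 : ℤ) ≤ ((hullClass hx hV U).card : ℤ) - 1
        omega)
      (Finset.mem_image_of_mem (hull hx hV) he)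
    have h2 := two_le_card_hullClass hx hV he
    rw [excess]
    simp only [hulls, Finset.card_empty] at h1 ⊢
    omega
  · have h1 := two_card_le_excess hx hV _ 𝒯 rfl hlam htight hsix hgap
    have hrne : (roots 𝒯).Nonempty := by
      obtain ⟨S, hS⟩ := hne
      obtain ⟨R, hR, -⟩ := exists_root 𝒯 hS
      exact ⟨R, hR⟩
    have h2 := sum_fracCut_le hx hV hV hrne hlam.disjointFamily_roots
      (fun S hS => ⟨htight S (Finset.mem_filter.1 hS).1, Finset.subset_univ _⟩)
    have h0 : fracCut x Finset.univ = 0 := by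
      rw [fracCut, Finset.card_eq_zero]
      exact Finset.filter_eq_empty_iff.2 fun e _ h => h.2 (inside_univ e)
    have h3 : excess hx hV (hullsWithin hx hV 𝒯) +
        excess hx hV (hullsBetween hx hV Finset.univ (roots 𝒯)) ≤ excess hx hV (hulls hx hV) := by
      refine excess_add_le hx hV subset_rfl (Finset.filter_subset _ _) (Finset.filter_subset _ _) ?_
      rw [Finset.disjoint_left]
      intro U hU hU'
      obtain ⟨-, T, hT, hUT⟩ := Finset.mem_filter.1 hU
      obtain ⟨R, hR, hTR⟩ := exists_root 𝒯 hT
      exact (Finset.mem_filter.1 hU').2.2 R hR (hUT.trans hTR)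
    have h4 : (1 : ℤ) ≤ (roots 𝒯).card := by exact_mod_cast hrne.card_pos
    rw [Finset.sum_sub_distrib, Finset.sum_const, nsmul_eq_mul] at h1
    rw [h0] at h2
    push_cast at h2
    linarith

end Counting

/-- Fewer homogeneous zero-one equations than unknowns have a nontrivial solution. -/
lemma exists_ne_zero_sum_eq_zero {α κ : Type*} [Fintype κ] (F : Finset α)
    (A : κ → Finset α) (hA : ∀ i, A i ⊆ F) (h : Fintype.card κ < F.card) :
    ∃ z : α → ℝ, z ≠ 0 ∧ (∀ e, e ∉ F → z e = 0) ∧ ∀ i, ∑ e ∈ A i, z e = 0 := by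
  let M : Matrix κ F ℝ := fun i e => if (e : α) ∈ A i then 1 else 0
  have hker : LinearMap.ker M.mulVecLin ≠ ⊥ := by
    apply LinearMap.ker_ne_bot_of_finrank_lt
    simpa using h
  obtain ⟨w, hw, hw0⟩ := (Submodule.ne_bot_iff _).1 hker
  have hz : ∀ e : F, (if h : (e : α) ∈ F then w ⟨e, h⟩ else 0) = w e := fun e => by simp
  refine ⟨fun e => if h : e ∈ F then w ⟨e, h⟩ else 0, ?_, fun e he => by simp [he], fun i => ?_⟩
  · intro h0
    refine hw0 (funext fun e => ?_)
    rw [← hz e]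
    exact congrFun h0 e
  · have h1 : (M.mulVec w) i = 0 := congrFun hw i
    refine Eq.trans ?_ h1
    rw [← Finset.inter_eq_right.2 (hA i), ← Finset.filter_mem_eq_inter, Finset.sum_filter,
      ← Finset.sum_coe_sort, Matrix.mulVec, dotProduct]
    refine Finset.sum_congr rfl fun e _ => ?_
    simp [M]

lemma sum_filter_inside_add_cut (x : Sym2 V → ℝ) (S : Finset V) (F : Finset (Sym2 V)) :
    ∑ e ∈ F with Inside S e, x e + ∑ e ∈ F with Crosses S e, x e =
      ∑ e ∈ F with Touches S e, x e := by
  rw [← Finset.sum_filter_add_sum_filter_not (F.filter (Touches S)) (Inside S),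
    Finset.filter_filter, Finset.filter_filter]
  congr 1
  · exact Finset.sum_congr (Finset.filter_congr fun e _ =>
      ⟨fun h => ⟨h.touches, h⟩, fun h => h.2⟩) fun _ _ => rfl
  · exact Finset.sum_congr (Finset.filter_congr fun e _ => Iff.rfl) fun _ _ => rfl

section Rounding

variable [Fintype V] {G : SimpleGraph V} {x : Sym2 V → ℝ}

lemma exists_int_sum_of_disjoint_fracEdges (A : Finset (Sym2 V)) :
    ∃ m : ℤ, ∑ e ∈ A with e ∉ fracEdges x, x e = m := by
  refine ⟨((A.filter fun e => e ∉ fracEdges x).filter fun e => x e = 1).card, ?_⟩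
  rw [Finset.card_filter]
  push_cast
  refine Finset.sum_congr rfl fun e he => ?_
  have := (Finset.mem_filter.1 he).2
  simp only [fracEdges, Finset.mem_filter, Finset.mem_univ, true_and, not_and_or, not_not] at this
  rcases this with h | h <;> simp [h]

lemma exists_int_sum_fracTouch {S : Finset V} (hS : Tight x S)
    (hcut : ∃ m : ℤ, cutWeight x S = m) : ∃ m : ℤ, ∑ e ∈ fracTouch x S, x e = m := by
  obtain ⟨m, hm⟩ := hcut
  obtain ⟨m', hm'⟩ := exists_int_sum_of_disjoint_fracEdges (x := x)
    (Finset.univ.filter (Touches S))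
  have h1 := sum_filter_inside_add_cut x S Finset.univ
  have h2 := hS.2
  rw [insideWeight] at h2
  rw [cutWeight] at hm
  have h3 := Finset.sum_filter_add_sum_filter_not (Finset.univ.filter (Touches S))
    (· ∈ fracEdges x) x
  have h4 : (Finset.univ.filter (Touches S)).filter (· ∈ fracEdges x) = fracTouch x S := by
    ext e; simp [fracTouch, and_comm]
  rw [h4, hm'] at h3
  refine ⟨(S.card : ℤ) - 1 + m - m', ?_⟩
  push_cast
  linarith

lemma fracTouch_mono {C S : Finset V} (h : C ⊆ S) : fracTouch x C ⊆ fracTouch x S :=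
  Finset.monotone_filter_right _ fun _ _ he => he.mono h

lemma sum_filter_eq_sum_univ {z : Sym2 V → ℝ} {F : Finset (Sym2 V)} (hz : ∀ e, e ∉ F → z e = 0)
    (P : Sym2 V → Prop) : ∑ e with P e, z e = ∑ e ∈ F with P e, z e := by
  symm
  refine Finset.sum_subset (Finset.filter_subset_filter _ (Finset.subset_univ _)) ?_
  intro e he he'
  refine hz e fun h => he' (Finset.mem_filter.2 ⟨h, (Finset.mem_filter.1 he).2⟩)

/-- A direction preserving all tight sets and a laminar family of integral cuts. -/
lemma exists_perturbation (hx : IsSubtour G x) (hV : Tight x Finset.univ)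
    (hF : (fracEdges x).Nonempty) (𝒯 : Finset (Finset V)) (hlam : LaminarFamily 𝒯)
    (htight : ∀ S ∈ 𝒯, Tight x S) (hsix : ∀ S ∈ 𝒯, 6 ≤ fracCut x S)
    (hcutint : ∀ S ∈ 𝒯, ∃ m : ℤ, cutWeight x S = m) :
    ∃ z : Sym2 V → ℝ, z ≠ 0 ∧ (∀ e, e ∉ fracEdges x → z e = 0) ∧
      (∀ U, Tight x U → insideWeight z U = 0) ∧ ∀ S ∈ 𝒯, cutWeight z S = 0 := by
  obtain ⟨s, hs, hbij⟩ := Set.exists_subset_bijOn (𝒯 : Set (Finset V)) (fracTouch x)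
  set 𝒯' := 𝒯.filter (· ∈ s) with h𝒯'
  have hsub : 𝒯' ⊆ 𝒯 := Finset.filter_subset _ _
  have hgap : ∀ S ∈ 𝒯', ∀ C ∈ 𝒯', C ⊂ S → 2 ≤ (fracTouch x S \ fracTouch x C).card := by
    intro S hS C hC hCS
    obtain ⟨hS1, hS2⟩ := Finset.mem_filter.1 hS
    obtain ⟨hC1, hC2⟩ := Finset.mem_filter.1 hC
    by_contra hlt
    have hle : (fracTouch x S \ fracTouch x C).card ≤ 1 := by omega
    have hmono := fracTouch_mono (x := x) hCS.1
    have hsum := Finset.sum_sdiff (f := x) hmono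
    obtain ⟨m1, hm1⟩ := exists_int_sum_fracTouch (htight S hS1) (hcutint S hS1)
    obtain ⟨m2, hm2⟩ := exists_int_sum_fracTouch (htight C hC1) (hcutint C hC1)
    rcases Nat.le_one_iff_eq_zero_or_eq_one.1 hle with h0 | h1
    · have : fracTouch x S = fracTouch x C := Finset.Subset.antisymm
        (Finset.sdiff_eq_empty_iff_subset.1 (Finset.card_eq_zero.1 h0)) hmono
      exact hCS.ne (hbij.injOn hC2 hS2 this.symm)
    · obtain ⟨e, h1⟩ := Finset.card_eq_one.1 h1
      rw [h1, Finset.sum_singleton, hm1, hm2] at hsum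
      have heF : e ∈ fracEdges x := by
        have : e ∈ fracTouch x S \ fracTouch x C := by rw [h1]; simp
        exact (Finset.mem_filter.1 (Finset.mem_sdiff.1 this).1).1
      refine not_int_of_mem_fracEdges hx heF (m1 - m2) ?_
      push_cast
      linarith
  have hlt := card_lt_excess hx hV hF 𝒯' (hlam.mono hsub) (fun S hS => htight S (hsub hS))
    (fun S hS => hsix S (hsub hS)) hgap
  obtain ⟨z, hz0, hzF, hz⟩ := exists_ne_zero_sum_eq_zero (κ := hulls hx hV ⊕ 𝒯')
    (fracEdges x) (Sum.elim (fun U => hullClass hx hV U) fun S => fracTouch x S)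
    (by rintro (U | S) <;> exact Finset.filter_subset _ _)
    (by simpa [add_comm] using hlt)
  have hins : ∀ U, Tight x U → ∑ e ∈ fracEdges x with Inside U e, z e = 0 := by
    intro U hU
    have h1 := sum_between hx hV hU (𝒮 := ∅) (by simp) z
    rw [Finset.filter_congr (fun e _ => show Separated U ∅ e ↔ Inside U e by
      simp [Separated])] at h1
    rw [h1]
    refine Finset.sum_eq_zero fun W hW => ?_
    exact hz (Sum.inl ⟨W, (Finset.mem_filter.1 hW).1⟩)
  refine ⟨z, hz0, hzF, fun U hU => ?_, fun S hS => ?_⟩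
  · rw [insideWeight, sum_filter_eq_sum_univ hzF, hins U hU]
  · have h1 := sum_filter_inside_add_cut z S (fracEdges x)
    rw [hins S (htight S hS), zero_add] at h1
    rw [cutWeight, sum_filter_eq_sum_univ hzF, h1]
    obtain ⟨S', hS', hSS⟩ := hbij.surjOn (Set.mem_image_of_mem _ hS)
    have h2 := hz (Sum.inr ⟨S', Finset.mem_filter.2 ⟨hs hS', hS'⟩⟩)
    change ∑ e ∈ fracTouch x S, z e = 0
    rw [← hSS]
    exact h2

lemma insideWeight_add_smul (y z : Sym2 V → ℝ) (ε : ℝ) (U : Finset V) :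
    insideWeight (y + ε • z) U = insideWeight y U + ε * insideWeight z U := by
  simp [insideWeight, Finset.sum_add_distrib, Finset.mul_sum]

lemma cutWeight_add_smul (y z : Sym2 V → ℝ) (ε : ℝ) (U : Finset V) :
    cutWeight (y + ε • z) U = cutWeight y U + ε * cutWeight z U := by
  simp [cutWeight, Finset.sum_add_distrib, Finset.mul_sum]

lemma continuous_insideWeight (U : Finset V) :
    Continuous fun y : Sym2 V → ℝ => insideWeight y U :=
  continuous_finsetSum _ fun e _ => continuous_apply e

lemma continuous_cutWeight (U : Finset V) :
    Continuous fun y : Sym2 V → ℝ => cutWeight y U :=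
  continuous_finsetSum _ fun e _ => continuous_apply e

lemma isClosed_setOf_isSubtour (G : SimpleGraph V) :
    IsClosed {y : Sym2 V → ℝ | IsSubtour G y} := by
  have : {y : Sym2 V → ℝ | IsSubtour G y} = {y | ∀ e, 0 ≤ y e} ∩
      ({y | ∀ e, e ∉ G.edgeSet → y e = 0} ∩
        {y | ∀ U : Finset V, U.Nonempty → insideWeight y U ≤ (U.card : ℝ) - 1}) := by
    ext y
    exact ⟨fun h => ⟨h.1, h.2, h.3⟩, fun h => ⟨h.1, h.2.1, h.2.2⟩⟩
  rw [this]
  simp only [Set.ofPred_forall]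
  refine IsClosed.inter (isClosed_iInter fun e => ?_) (IsClosed.inter (isClosed_iInter fun e =>
    isClosed_iInter fun _ => ?_) (isClosed_iInter fun U => isClosed_iInter fun _ => ?_))
  · exact isClosed_le continuous_const (continuous_apply e)
  · exact isClosed_eq (continuous_apply e) continuous_const
  · exact isClosed_le (continuous_insideWeight U) continuous_const

lemma isClosed_setOf_tight (U : Finset V) : IsClosed {y : Sym2 V → ℝ | Tight y U} := by
  by_cases h : U.Nonempty
  · simp only [Tight, h, true_and]
    exact isClosed_eq (continuous_insideWeight U) continuous_const
  · simp [Tight, h]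

/-- Subtour vectors tight on `𝓕`, agreeing with `x` off its fractional edges and obeying the
cut bounds `b` on `𝓛`. -/
def roundingPolytope (G : SimpleGraph V) (𝓕 𝓛 : Finset (Finset V)) (b : Finset V → ℤ)
    (x : Sym2 V → ℝ) : Set (Sym2 V → ℝ) :=
  {y | IsSubtour G y ∧ (∀ S ∈ 𝓕, Tight y S) ∧ (∀ e, e ∉ fracEdges x → y e = x e) ∧
    ∀ S ∈ 𝓛, cutWeight y S ≤ b S}

lemma isCompact_roundingPolytope (G : SimpleGraph V) (𝓕 𝓛 : Finset (Finset V))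
    (b : Finset V → ℤ) (x : Sym2 V → ℝ) : IsCompact (roundingPolytope G 𝓕 𝓛 b x) := by
  have hcl : IsClosed (roundingPolytope G 𝓕 𝓛 b x) := by
    have : roundingPolytope G 𝓕 𝓛 b x = {y | IsSubtour G y} ∩ ({y | ∀ S ∈ 𝓕, Tight y S} ∩
      ({y | ∀ e, e ∉ fracEdges x → y e = x e} ∩ {y | ∀ S ∈ 𝓛, cutWeight y S ≤ b S})) := rfl
    rw [this]
    simp only [Set.ofPred_forall]
    refine (isClosed_setOf_isSubtour G).inter (IsClosed.inter ?_ (IsClosed.inter ?_ ?_))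
    · exact isClosed_iInter fun S => isClosed_iInter fun _ => isClosed_setOf_tight S
    · exact isClosed_iInter fun e => isClosed_iInter fun _ =>
        isClosed_eq (continuous_apply e) continuous_const
    · exact isClosed_iInter fun S => isClosed_iInter fun _ =>
        isClosed_le (continuous_cutWeight S) continuous_const
  refine (isCompact_univ_pi fun _ : Sym2 V => isCompact_Icc (a := (0 : ℝ)) (b := 1)).of_isClosed_subset
    hcl fun y hy e _ => ⟨hy.1.nonneg e, hy.1.le_one e⟩

open Filter Topology in
/-- Moving slightly along a direction found by `exists_perturbation` stays in the polytope. -/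
lemma eventually_mem_roundingPolytope {𝓕 𝓛 : Finset (Finset V)} {b : Finset V → ℤ}
    {y z : Sym2 V → ℝ} (hy : y ∈ roundingPolytope G 𝓕 𝓛 b x)
    (hzF : ∀ e, e ∉ fracEdges y → z e = 0) (hzU : ∀ U, Tight y U → insideWeight z U = 0)
    (hzS : ∀ S ∈ 𝓛, cutWeight y S = b S → cutWeight z S = 0) :
    ∀ᶠ ε : ℝ in 𝓝 0, y + ε • z ∈ roundingPolytope G 𝓕 𝓛 b x := by
  obtain ⟨hsub, htight, hfix, hcut⟩ := hy
  have hlin : ∀ {p q c : ℝ}, p < c → ∀ᶠ ε : ℝ in 𝓝 0, p + ε * q < c := by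
    intro p q c h
    have hc : Continuous fun ε : ℝ => p + ε * q := by fun_prop
    exact hc.continuousAt.eventually_lt continuousAt_const (by simpa using h)
  have hlin' : ∀ {p q c : ℝ}, c < p → ∀ᶠ ε : ℝ in 𝓝 0, c < p + ε * q := by
    intro p q c h
    have hc : Continuous fun ε : ℝ => p + ε * q := by fun_prop
    exact continuousAt_const.eventually_lt hc.continuousAt (by simpa using h)
  have h1 : ∀ᶠ ε : ℝ in 𝓝 0, ∀ e, 0 ≤ y e + ε * z e := by
    refine eventually_all.2 fun e => ?_
    by_cases he : e ∈ fracEdges y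
    · have hpos : 0 < y e := lt_of_le_of_ne (hsub.nonneg e) (ne_zero_of_mem_fracEdges he).symm
      exact (hlin' hpos).mono fun ε h => h.le
    · exact Eventually.of_forall fun ε => by rw [hzF e he]; simpa using hsub.nonneg e
  have h2 : ∀ᶠ ε : ℝ in 𝓝 0, ∀ U : Finset V, U.Nonempty →
      insideWeight y U + ε * insideWeight z U ≤ (U.card : ℝ) - 1 := by
    refine eventually_all.2 fun U => ?_
    by_cases hU : U.Nonempty
    · rcases (hsub.le U hU).lt_or_eq with hlt | heq
      · exact (hlin hlt).mono fun ε h _ => h.le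
      · exact Eventually.of_forall fun ε _ => by rw [hzU U ⟨hU, heq⟩, heq]; simp
    · exact Eventually.of_forall fun ε h => absurd h hU
  have h3 : ∀ᶠ ε : ℝ in 𝓝 0, ∀ S : Finset V, S ∈ 𝓛 →
      cutWeight y S + ε * cutWeight z S ≤ b S := by
    refine eventually_all.2 fun S => ?_
    by_cases hS : S ∈ 𝓛
    · rcases (hcut S hS).lt_or_eq with hlt | heq
      · exact (hlin hlt).mono fun ε h _ => h.le
      · exact Eventually.of_forall fun ε _ => by rw [hzS S hS heq, heq]; simp
    · exact Eventually.of_forall fun ε h => absurd h hS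
  filter_upwards [h1, h2, h3] with ε h1 h2 h3
  have hfrac : ∀ e, e ∉ fracEdges x → z e = 0 := by
    intro e he
    refine hzF e fun h => he ?_
    simp only [fracEdges, Finset.mem_filter] at h ⊢
    rwa [hfix e he] at h
  refine ⟨⟨fun e => by simpa using h1 e, fun e he => ?_, fun U hU => ?_⟩, fun S hS => ?_,
    fun e he => ?_, fun S hS => ?_⟩
  · have h0 := hsub.support e he
    have : e ∉ fracEdges y := fun h => ne_zero_of_mem_fracEdges h h0
    simp [h0, hzF e this]
  · rw [insideWeight_add_smul]
    exact h2 U hU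
  · refine ⟨(htight S hS).1, ?_⟩
    rw [insideWeight_add_smul, hzU S (htight S hS), mul_zero, add_zero]
    exact (htight S hS).2
  · simp [hfrac e he, hfix e he]
  · rw [cutWeight_add_smul]
    exact h3 S hS

/-- At an extreme point either nothing is fractional or some constrained cut has few fractional
edges. -/
lemma exists_extreme_rounding {𝓕 𝓛 : Finset (Finset V)} {b : Finset V → ℤ}
    (huniv : Finset.univ ∈ 𝓕) (hlam : LaminarFamily 𝓕) (h𝓛 : 𝓛 ⊆ 𝓕)
    (hne : (roundingPolytope G 𝓕 𝓛 b x).Nonempty) :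
    ∃ y ∈ roundingPolytope G 𝓕 𝓛 b x,
      fracEdges y = ∅ ∨ ∃ S ∈ 𝓛, fracCut y S ≤ 5 := by
  obtain ⟨y, hy⟩ := (isCompact_roundingPolytope G 𝓕 𝓛 b x).extremePoints_nonempty hne
  obtain ⟨hyP, hext⟩ := mem_extremePoints_iff_left.1 hy
  refine ⟨y, hyP, ?_⟩
  by_contra hcon
  push Not at hcon
  obtain ⟨hF, hsix⟩ := hcon
  obtain ⟨z, hz0, hzF, hzU, hzS⟩ := exists_perturbation hyP.1 (hyP.2.1 _ huniv) hF
    (𝓛.filter fun S => cutWeight y S = b S)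
    (hlam.mono ((Finset.filter_subset _ _).trans h𝓛))
    (fun S hS => hyP.2.1 S (h𝓛 (Finset.mem_filter.1 hS).1))
    (fun S hS => hsix S (Finset.mem_filter.1 hS).1)
    (fun S hS => ⟨b S, (Finset.mem_filter.1 hS).2⟩)
  have hev := eventually_mem_roundingPolytope hyP hzF hzU
    (fun S hS h => hzS S (Finset.mem_filter.2 ⟨hS, h⟩))
  obtain ⟨δ, hδ, hball⟩ := Metric.eventually_nhds_iff.1 hev
  have hd : |δ / 2| < δ := by rw [abs_of_pos (by linarith)]; linarith
  have hp : y + (δ / 2) • z ∈ roundingPolytope G 𝓕 𝓛 b x :=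
    hball (by rwa [Real.dist_eq, sub_zero])
  have hm : y + (-(δ / 2)) • z ∈ roundingPolytope G 𝓕 𝓛 b x :=
    hball (by rwa [Real.dist_eq, sub_zero, abs_neg])
  have heq := hext _ hp _ hm ⟨1 / 2, 1 / 2, by norm_num, by norm_num, by norm_num, by
    ext e
    simp only [Pi.add_apply, Pi.smul_apply, smul_eq_mul]
    ring⟩
  apply hz0
  have h1 : (δ / 2) • z = 0 := by simpa using heq
  exact (smul_eq_zero.1 h1).resolve_left (by linarith)

/-- A vector aligned with a laminar family can be rounded to an integral one, increasing each
prescribed integral cut bound by at most five. -/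
theorem exists_integral_rounding {𝓕 : Finset (Finset V)} (huniv : Finset.univ ∈ 𝓕)
    (hlam : LaminarFamily 𝓕) (b : Finset V → ℤ) (n : ℕ) :
    ∀ (𝓛 : Finset (Finset V)) (x : Sym2 V → ℝ), 𝓛.card = n → 𝓛 ⊆ 𝓕 → IsSubtour G x →
      (∀ S ∈ 𝓕, Tight x S) → (∀ S ∈ 𝓛, cutWeight x S ≤ b S) →
      ∃ t, IsSubtour G t ∧ (∀ S ∈ 𝓕, Tight t S) ∧ (∀ e, t e = 0 ∨ t e = 1) ∧
        (∀ e, e ∉ fracEdges x → t e = x e) ∧ ∀ S ∈ 𝓛, cutWeight t S ≤ b S + 5 := by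
  induction n with
  | zero =>
    intro 𝓛 x hcard h𝓛 hx htight hcut
    rw [Finset.card_eq_zero] at hcard
    subst hcard
    obtain ⟨y, hy, h⟩ := exists_extreme_rounding huniv hlam h𝓛 ⟨x, hx, htight, fun _ _ => rfl, hcut⟩
    have hF : fracEdges y = ∅ := by simpa using h
    refine ⟨y, hy.1, hy.2.1, fun e => ?_, hy.2.2.1, by simp⟩
    by_contra hcon
    push Not at hcon
    have : e ∈ fracEdges y := by simp [fracEdges, hcon]
    simp [hF] at this
  | succ n ih =>
    intro 𝓛 x hcard h𝓛 hx htight hcut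
    obtain ⟨y, hy, h⟩ := exists_extreme_rounding huniv hlam h𝓛 ⟨x, hx, htight, fun _ _ => rfl, hcut⟩
    obtain ⟨hsub, hytight, hfix, hycut⟩ := hy
    rcases h with hF | ⟨S, hS, h5⟩
    · refine ⟨y, hsub, hytight, fun e => ?_, hfix, fun S hS => ?_⟩
      · by_contra hcon
        push Not at hcon
        have : e ∈ fracEdges y := by simp [fracEdges, hcon]
        simp [hF] at this
      · linarith [hycut S hS]
    · obtain ⟨t, ht, httight, ht01, htfix, htcut⟩ := ih (𝓛.erase S) y
        (by rw [Finset.card_erase_of_mem hS, hcard]; rfl) ((Finset.erase_subset _ _).trans h𝓛)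
        hsub hytight (fun T hT => hycut T (Finset.mem_of_mem_erase hT))
      refine ⟨t, ht, httight, ht01, fun e he => ?_, fun T hT => ?_⟩
      · have : e ∉ fracEdges y := by
          intro h
          apply he
          simp only [fracEdges, Finset.mem_filter] at h ⊢
          rwa [hfix e he] at h
        rw [htfix e this, hfix e he]
      · by_cases hTS : T = S
        · subst hTS
          have hle : cutWeight t T ≤ cutWeight y T + fracCut y T := by
            have h1 : (fracCut y T : ℝ) =
                ∑ e with Crosses T e, if e ∈ fracEdges y then (1 : ℝ) else 0 := by
              rw [Finset.sum_boole, Finset.filter_filter, fracCut]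
              congr 2
              ext e
              simp [and_comm]
            rw [h1, cutWeight, cutWeight, ← Finset.sum_add_distrib]
            refine Finset.sum_le_sum fun e _ => ?_
            split_ifs with h
            · linarith [ht.le_one e, hsub.nonneg e]
            · rw [htfix e h, add_zero]
          have h5' : (fracCut y T : ℝ) ≤ 5 := by exact_mod_cast h5
          linarith [hycut T hT]
        · exact htcut T (Finset.mem_erase.2 ⟨hTS, hT⟩)

end Rounding

section Alignment

variable [Fintype V] {G : SimpleGraph V} {k : ℕ}

/-- The edges of `G` as a set of pairs. -/
def edges (G : SimpleGraph V) : Finset (Sym2 V) := Finset.univ.filter fun e => e ∈ G.edgeSet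

/-- The edges of `G` between `A` and `B`. -/
def edgesBetween (G : SimpleGraph V) (A B : Finset V) : Finset (Sym2 V) :=
  (edges G).filter fun e => Touches A e ∧ Touches B e

/-- The edges of `G` crossing `S`. -/
def cut (G : SimpleGraph V) (S : Finset V) : Finset (Sym2 V) := (edges G).filter (Crosses S)

/-- Every cut of the subgraph induced on `U` has at least `k / 4` edges. -/
def QuarterConnected (G : SimpleGraph V) (k : ℕ) (U : Finset V) : Prop :=
  U.Nonempty ∧ ∀ A : Finset V, A.Nonempty → A ⊂ U → k ≤ 4 * (edgesBetween G A (U \ A)).card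

lemma edgesBetween_mono {A A' B B' : Finset V} (hA : A ⊆ A') (hB : B ⊆ B') :
    edgesBetween G A B ⊆ edgesBetween G A' B' :=
  Finset.monotone_filter_right _ fun _ _ h => ⟨h.1.mono hA, h.2.mono hB⟩

lemma quarterConnected_singleton (v : V) : QuarterConnected G k {v} := by
  refine ⟨⟨v, by simp⟩, fun A hA hlt => ?_⟩
  rw [Finset.ssubset_singleton_iff] at hlt
  exact absurd hlt hA.ne_empty

lemma QuarterConnected.union {U W : Finset V} (hU : QuarterConnected G k U)
    (hW : QuarterConnected G k W) (hUW : (U ∩ W).Nonempty) : QuarterConnected G k (U ∪ W) := by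
  have key : ∀ U' : Finset V, QuarterConnected G k U' → U' ⊆ U ∪ W → ∀ A : Finset V,
      ¬ k ≤ 4 * (edgesBetween G A ((U ∪ W) \ A)).card → A ∩ U' = ∅ ∨ U' ⊆ A := by
    intro U' hU' hsub A hlt
    by_contra hcon
    push Not at hcon
    have h1 := hU'.2 (A ∩ U') hcon.1
      ⟨Finset.inter_subset_right, fun h => hcon.2 (h.trans Finset.inter_subset_left)⟩
    have h2 := Finset.card_le_card (edgesBetween_mono (G := G) (A := A ∩ U') (A' := A)
      (B := U' \ (A ∩ U')) (B' := (U ∪ W) \ A) Finset.inter_subset_left (by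
        rw [Finset.sdiff_inter_self_right]
        exact Finset.sdiff_subset_sdiff hsub subset_rfl))
    omega
  refine ⟨hUW.mono (Finset.inter_subset_left.trans Finset.subset_union_left), fun A hA hlt => ?_⟩
  by_contra hcon
  obtain ⟨v, hv⟩ := hUW
  rw [Finset.mem_inter] at hv
  rcases key U hU Finset.subset_union_left A hcon with h1 | h1 <;>
    rcases key W hW Finset.subset_union_right A hcon with h2 | h2
  · obtain ⟨w, hw⟩ := hA
    rcases Finset.mem_union.1 (hlt.1 hw) with h | h
    · exact Finset.eq_empty_iff_forall_notMem.1 h1 w (Finset.mem_inter.2 ⟨hw, h⟩)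
    · exact Finset.eq_empty_iff_forall_notMem.1 h2 w (Finset.mem_inter.2 ⟨hw, h⟩)
  · exact Finset.eq_empty_iff_forall_notMem.1 h1 v (Finset.mem_inter.2 ⟨h2 hv.2, hv.1⟩)
  · exact Finset.eq_empty_iff_forall_notMem.1 h2 v (Finset.mem_inter.2 ⟨h1 hv.1, hv.2⟩)
  · exact hlt.2 (Finset.union_subset h1 h2)

/-- The maximal quarter-connected subsets of `S`. -/
def components (G : SimpleGraph V) (k : ℕ) (S : Finset V) : Finset (Finset V) :=
  roots (Finset.univ.filter fun U => QuarterConnected G k U ∧ U ⊆ S)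

lemma mem_components {S C : Finset V} : C ∈ components G k S ↔
    (QuarterConnected G k C ∧ C ⊆ S) ∧
      ∀ U, QuarterConnected G k U → U ⊆ S → C ⊆ U → C = U := by
  simp only [components, roots, MaximalIn, Finset.mem_filter, Finset.mem_univ, true_and, and_imp]

lemma subset_component_of_inter {S C U : Finset V} (hC : C ∈ components G k S)
    (hU : QuarterConnected G k U) (hUS : U ⊆ S) (hne : (C ∩ U).Nonempty) : U ⊆ C := by
  obtain ⟨⟨hC1, hC2⟩, hmax⟩ := mem_components.1 hC
  have := hmax (C ∪ U) (hC1.union hU hne) (Finset.union_subset hC2 hUS) Finset.subset_union_left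
  rw [this]
  exact Finset.subset_union_right

lemma disjointFamily_components (S : Finset V) : DisjointFamily (components G k S) := by
  intro C hC D hD hne
  rw [Finset.disjoint_iff_inter_eq_empty]
  by_contra h
  have h := Finset.nonempty_iff_ne_empty.2 h
  obtain ⟨⟨hC1, hC2⟩, -⟩ := mem_components.1 hC
  obtain ⟨⟨hD1, hD2⟩, -⟩ := mem_components.1 hD
  exact hne (Finset.Subset.antisymm
    (subset_component_of_inter hD hC1 hC2 (by rwa [Finset.inter_comm]))
    (subset_component_of_inter hC hD1 hD2 h))

lemma exists_component_superset {S U : Finset V} (hU : QuarterConnected G k U) (hUS : U ⊆ S) :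
    ∃ C ∈ components G k S, U ⊆ C :=
  exists_root _ (by simp [hU, hUS])

lemma exists_mem_component {S : Finset V} {v : V} (hv : v ∈ S) :
    ∃ C ∈ components G k S, v ∈ C := by
  obtain ⟨C, hC, h⟩ := exists_component_superset (G := G) (k := k)
    (quarterConnected_singleton v) (Finset.singleton_subset_iff.2 hv)
  exact ⟨C, hC, h (by simp)⟩

/-- Few edges join distinct components. -/
lemma card_separated_components (n : ℕ) : ∀ S : Finset V, S.card = n → S.Nonempty →
    4 * ((edges G).filter (Separated S (components G k S))).card + k ≤
      k * (components G k S).card := by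
  induction n using Nat.strong_induction_on with
  | _ n ih =>
    intro S hcard hne
    by_cases hS : QuarterConnected G k S
    · have hSc : S ∈ components G k S :=
        mem_components.2 ⟨⟨hS, subset_rfl⟩, fun U _ hU hSU => Finset.Subset.antisymm hSU hU⟩
      have h0 : (edges G).filter (Separated S (components G k S)) = ∅ :=
        Finset.filter_eq_empty_iff.2 fun e _ h => h.2 S hSc h.1
      have h1 : 0 < (components G k S).card := Finset.card_pos.2 ⟨S, hSc⟩
      rw [h0]
      simpa using Nat.le_mul_of_pos_right k h1
    · have : ∃ A : Finset V, A.Nonempty ∧ A ⊂ S ∧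
          4 * (edgesBetween G A (S \ A)).card < k := by
        by_contra hcon
        push Not at hcon
        exact hS ⟨hne, hcon⟩
      obtain ⟨A, hA, hAS, hlt⟩ := this
      have hB : (S \ A).Nonempty := Finset.sdiff_nonempty.2 hAS.2
      have hsplit : ∀ U, QuarterConnected G k U → U ⊆ S → U ⊆ A ∨ U ⊆ S \ A := by
        intro U hU hUS
        by_contra hcon
        push Not at hcon
        have hne' : (U ∩ A).Nonempty := by
          rw [Finset.nonempty_iff_ne_empty]
          intro h
          exact hcon.2 (Finset.subset_sdiff.2 ⟨hUS, Finset.disjoint_iff_inter_eq_empty.2 h⟩)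
        have h1 := hU.2 (U ∩ A) hne'
          ⟨Finset.inter_subset_left, fun h => hcon.1 (h.trans Finset.inter_subset_right)⟩
        have h2 := Finset.card_le_card (edgesBetween_mono (G := G) (A := U ∩ A) (A' := A)
          (B := U \ (U ∩ A)) (B' := S \ A) Finset.inter_subset_right (by
            rw [Finset.sdiff_inter_self_left]
            exact Finset.sdiff_subset_sdiff hUS subset_rfl))
        omega
      have hdisj : Disjoint A (S \ A) := Finset.disjoint_sdiff
      have hlift : ∀ X Y : Finset V, Disjoint X Y → X ⊆ S →
          (∀ U, QuarterConnected G k U → U ⊆ S → U ⊆ X ∨ U ⊆ Y) →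
          components G k X ⊆ components G k S := by
        intro X Y hXY hXS h C hC
        obtain ⟨⟨hC1, hC2⟩, hmax⟩ := mem_components.1 hC
        refine mem_components.2 ⟨⟨hC1, hC2.trans hXS⟩, fun U hU hUS hCU => ?_⟩
        rcases h U hU hUS with h | h
        · exact hmax U hU h hCU
        · obtain ⟨v, hv⟩ := hC1.1
          exact absurd (h (hCU hv)) (Finset.disjoint_left.1 hXY (hC2 hv))
      have hcA := hlift A (S \ A) hdisj hAS.1 hsplit
      have hcB := hlift (S \ A) A hdisj.symm Finset.sdiff_subset
        fun U hU hUS => (hsplit U hU hUS).symm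
      have hcd : Disjoint (components G k A) (components G k (S \ A)) := by
        rw [Finset.disjoint_left]
        intro C hC hC'
        obtain ⟨⟨hC1, hC2⟩, -⟩ := mem_components.1 hC
        obtain ⟨⟨-, hC3⟩, -⟩ := mem_components.1 hC'
        obtain ⟨v, hv⟩ := hC1.1
        exact Finset.disjoint_left.1 hdisj (hC2 hv) (hC3 hv)
      have hcards : (components G k A).card + (components G k (S \ A)).card ≤
          (components G k S).card := by
        rw [← Finset.card_union_of_disjoint hcd]
        exact Finset.card_le_card (Finset.union_subset hcA hcB)
      have hsub : (edges G).filter (Separated S (components G k S)) ⊆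
          (edges G).filter (Separated A (components G k A)) ∪
            ((edges G).filter (Separated (S \ A) (components G k (S \ A))) ∪
              edgesBetween G A (S \ A)) := by
        intro e he
        obtain ⟨heG, hin, hsep⟩ := Finset.mem_filter.1 he
        rw [Finset.mem_union, Finset.mem_union]
        by_cases h1 : Inside A e
        · exact Or.inl (Finset.mem_filter.2 ⟨heG, h1, fun C hC => hsep C (hcA hC)⟩)
        · by_cases h2 : Inside (S \ A) e
          · exact Or.inr (Or.inl (Finset.mem_filter.2 ⟨heG, h2, fun C hC => hsep C (hcB hC)⟩))
          · refine Or.inr (Or.inr (Finset.mem_filter.2 ⟨heG, ?_⟩))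
            simp only [Inside] at h1 h2
            push Not at h1 h2
            obtain ⟨v, hv, hvA⟩ := h1
            obtain ⟨w, hw, hwA⟩ := h2
            refine ⟨⟨w, hw, ?_⟩, v, hv, Finset.mem_sdiff.2 ⟨hin v hv, hvA⟩⟩
            by_contra h
            exact hwA (Finset.mem_sdiff.2 ⟨hin w hw, h⟩)
      have h1 := (Finset.card_le_card hsub).trans (Finset.card_union_le _ _)
      have h2 := Finset.card_union_le
        ((edges G).filter (Separated (S \ A) (components G k (S \ A)))) (edgesBetween G A (S \ A))
      have hA' := ih A.card (hcard ▸ Finset.card_lt_card hAS) A rfl hA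
      have hB' := ih (S \ A).card (by
        rw [← hcard]
        refine Finset.card_lt_card ⟨Finset.sdiff_subset, fun h => ?_⟩
        obtain ⟨v, hv⟩ := hA
        exact (Finset.mem_sdiff.1 (h (hAS.1 hv))).2 hv) _ rfl hB
      have hmul := Nat.mul_le_mul_left k hcards
      rw [Nat.mul_add] at hmul
      omega

/-- The components of a proper subset are few and have small total cut size. -/
lemma components_bounds
    (hconn : ∀ S : Finset V, S.Nonempty → S ≠ Finset.univ → k ≤ (cut G S).card)
    {S : Finset V} (hne : S.Nonempty) (hS : S ≠ Finset.univ) :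
    ∑ C ∈ components G k S, (cut G C).card ≤ 2 * (cut G S).card ∧
      k * (components G k S).card ≤ 2 * (cut G S).card := by
  have hsep := card_separated_components (G := G) (k := k) _ S rfl hne
  have hsub : ∀ C ∈ components G k S, C ⊆ S := fun C hC => (mem_components.1 hC).1.2
  have h1 := sum_card_crosses_le (edges G) (disjointFamily_components S) hsub
  have h2 : ∑ e ∈ (edges G).filter (Separated S (components G k S)),
      ((components G k S).filter fun C => Touches C e).card ≤
      ((edges G).filter (Separated S (components G k S))).card * 2 :=
    Finset.sum_le_card_nsmul _ _ 2 fun e _ =>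
      card_filter_touches_le_two (disjointFamily_components S) e
  have h3 : (components G k S).card * k ≤ ∑ C ∈ components G k S, (cut G C).card :=
    Finset.card_nsmul_le_sum _ _ k fun C hC => hconn C (mem_components.1 hC).1.1.1 (by
      rintro rfl
      exact hS (Finset.univ_subset_iff.1 (hsub _ hC)))
  change ∑ C ∈ components G k S, (cut G C).card ≤ _ + (cut G S).card at h1
  rw [Nat.mul_comm] at h3
  constructor <;> omega

lemma quarterConnected_univ [Nonempty V]
    (hconn : ∀ S : Finset V, S.Nonempty → S ≠ Finset.univ → k ≤ (cut G S).card) :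
    QuarterConnected G k Finset.univ := by
  refine ⟨Finset.univ_nonempty, fun A hA hlt => ?_⟩
  have h1 := hconn A hA hlt.ne
  have h2 : cut G A ⊆ edgesBetween G A (Finset.univ \ A) := by
    refine Finset.monotone_filter_right _ fun e _ h => ⟨h.1, ?_⟩
    have h3 := h.2
    simp only [Inside] at h3
    push Not at h3
    obtain ⟨v, hv, hvA⟩ := h3
    exact ⟨v, hv, by simp [hvA]⟩
  have := Finset.card_le_card h2
  omega

/-- Components of the members of a laminar family form a laminar family. -/
lemma LaminarFamily.components {𝓛 : Finset (Finset V)} (h : LaminarFamily 𝓛) :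
    LaminarFamily (𝓛.biUnion (components G k)) := by
  have key : ∀ S T C D : Finset V, S ⊆ T → C ∈ _root_.components G k S →
      D ∈ _root_.components G k T → Disjoint C D ∨ C ⊆ D := by
    intro S T C D hST hC hD
    obtain ⟨⟨hC1, hC2⟩, -⟩ := mem_components.1 hC
    by_cases hne : (D ∩ C).Nonempty
    · exact Or.inr (subset_component_of_inter hD hC1 (hC2.trans hST) hne)
    · exact Or.inl (Finset.disjoint_iff_inter_eq_empty.2
        (by rwa [Finset.inter_comm, ← Finset.not_nonempty_iff_eq_empty]))
  intro C hC D hD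
  obtain ⟨S, hS, hCS⟩ := Finset.mem_biUnion.1 hC
  obtain ⟨T, hT, hDT⟩ := Finset.mem_biUnion.1 hD
  rcases h S hS T hT with hST | hST | hST
  · exact Or.inl (hST.mono (mem_components.1 hCS).1.2 (mem_components.1 hDT).1.2)
  · exact (key S T C D hST hCS hDT).imp_right Or.inl
  · exact (key T S D C hST hDT hCS).imp (fun h => h.symm) Or.inr

end Alignment
section StartingPoint

variable [Fintype V] {G : SimpleGraph V} {k : ℕ}

open Filter Topology in
/-- A subtour vector bounded by `c` can be increased inside `S` until every edge inside `S`
either has weight `c` or lies inside a tight set. -/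
lemma exists_saturated_extension {y : Sym2 V → ℝ} {c : ℝ} (hy : IsSubtour G y)
    (hyc : ∀ e, y e ≤ c) (S : Finset V) :
    ∃ w, IsSubtour G w ∧ (∀ e, y e ≤ w e) ∧ (∀ e, w e ≤ c) ∧
      (∀ e, ¬ Inside S e → w e = y e) ∧
      ∀ e ∈ G.edgeSet, Inside S e → w e < c → ∃ U, Tight w U ∧ Inside U e := by
  set K : Set (Sym2 V → ℝ) := {w | IsSubtour G w} ∩ ({w | ∀ e, y e ≤ w e} ∩
    ({w | ∀ e, w e ≤ c} ∩ {w | ∀ e, ¬ Inside S e → w e = y e})) with hK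
  have hcl : IsClosed K := by
    rw [hK]
    simp only [Set.ofPred_forall]
    refine (isClosed_setOf_isSubtour G).inter (IsClosed.inter ?_ (IsClosed.inter ?_ ?_))
    · exact isClosed_iInter fun e => isClosed_le continuous_const (continuous_apply e)
    · exact isClosed_iInter fun e => isClosed_le (continuous_apply e) continuous_const
    · exact isClosed_iInter fun e => isClosed_iInter fun _ =>
        isClosed_eq (continuous_apply e) continuous_const
  have hcomp : IsCompact K :=
    (isCompact_univ_pi fun _ : Sym2 V => isCompact_Icc (a := (0 : ℝ)) (b := 1)).of_isClosed_subset
      hcl fun w hw e _ => ⟨hw.1.nonneg e, hw.1.le_one e⟩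
  obtain ⟨w, ⟨hw, hyw, hwc, hfix⟩, hmax⟩ := hcomp.exists_isMaxOn
    ⟨y, hy, fun _ => le_rfl, hyc, fun _ _ => rfl⟩
    (f := fun w : Sym2 V → ℝ => ∑ e, w e)
    (continuous_finsetSum _ fun e _ => continuous_apply e).continuousOn
  refine ⟨w, hw, hyw, hwc, hfix, fun e he heS hlt => ?_⟩
  by_contra hcon
  push Not at hcon
  have hlin : ∀ {p q d : ℝ}, p < d → ∀ᶠ ε : ℝ in 𝓝 0, p + ε * q < d := by
    intro p q d h
    have hc : Continuous fun ε : ℝ => p + ε * q := by fun_prop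
    exact hc.continuousAt.eventually_lt continuousAt_const (by simpa using h)
  set z : Sym2 V → ℝ := fun f => if f = e then 1 else 0 with hz
  have h2 : ∀ᶠ ε : ℝ in 𝓝 0, ∀ U : Finset V, U.Nonempty →
      insideWeight w U + ε * insideWeight z U ≤ (U.card : ℝ) - 1 := by
    refine eventually_all.2 fun U => ?_
    by_cases hU : U.Nonempty
    · rcases (hw.le U hU).lt_or_eq with hlt | heq
      · exact (hlin hlt).mono fun ε h _ => h.le
      · have : insideWeight z U = 0 := by
          refine Finset.sum_eq_zero fun f hf => if_neg ?_
          rintro rfl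
          exact hcon U ⟨hU, heq⟩ (Finset.mem_filter.1 hf).2
        exact Eventually.of_forall fun ε _ => by rw [this, heq]; simp
    · exact Eventually.of_forall fun ε h => absurd h hU
  obtain ⟨δ, hδ, hball⟩ := Metric.eventually_nhds_iff.1 (h2.and (hlin (q := 1) hlt))
  have hd : |δ / 2| < δ := by rw [abs_of_pos (by linarith)]; linarith
  obtain ⟨hin, hle⟩ := hball (y := δ / 2) (by rwa [Real.dist_eq, sub_zero])
  have hval : ∀ f, (w + (δ / 2) • z) f = w f + if f = e then δ / 2 else 0 := by
    intro f
    simp only [hz, Pi.add_apply, Pi.smul_apply, smul_eq_mul, mul_ite, mul_one, mul_zero]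
  have hge : ∀ f, w f ≤ (w + (δ / 2) • z) f := by
    intro f
    rw [hval]
    split_ifs <;> linarith
  have hmem : w + (δ / 2) • z ∈ K := by
    refine ⟨⟨fun f => (hw.nonneg f).trans (hge f), fun f hf => ?_, fun U hU => ?_⟩,
      fun f => (hyw f).trans (hge f), fun f => ?_, fun f hf => ?_⟩
    · rw [hval, hw.support f hf, if_neg (by rintro rfl; exact hf he), add_zero]
    · rw [insideWeight_add_smul]
      exact hin U hU
    · rw [hval]
      split_ifs with h
      · subst h; linarith
      · linarith [hwc f]
    · rw [hval, hfix f hf, if_neg (by rintro rfl; exact hf heS), add_zero]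
  have h3 : ∑ f, (w + (δ / 2) • z) f ≤ ∑ f, w f := hmax hmem
  simp only [hval, Finset.sum_add_distrib, Finset.sum_ite_eq', Finset.mem_univ, if_true] at h3
  linarith

lemma tight_singleton {w : Sym2 V → ℝ} (hw : IsSubtour G w) (v : V) : Tight w {v} := by
  refine ⟨⟨v, by simp⟩, le_antisymm (hw.le _ ⟨v, by simp⟩) ?_⟩
  rw [Finset.card_singleton, Nat.cast_one, sub_self]
  exact Finset.sum_nonneg fun e _ => hw.nonneg e

/-- A tight set meeting `S` lies in `S` when no positive edge crosses `S`. -/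
lemma Tight.subset_of_inter {w : Sym2 V → ℝ} (hw : IsSubtour G w) {S U : Finset V}
    (hsupp : ∀ e, w e ≠ 0 → Inside S e ∨ ¬ Touches S e) (hU : Tight w U)
    (hne : (U ∩ S).Nonempty) : U ⊆ S := by
  by_contra hcon
  have hne' : (U \ S).Nonempty := Finset.sdiff_nonempty.2 hcon
  have h1 := hw.le _ hne
  have h2 := hw.le _ hne'
  have h3 : insideWeight w U ≤ insideWeight w (U ∩ S) + insideWeight w (U \ S) := by
    rw [insideWeight_eq_sum_ite, insideWeight_eq_sum_ite, insideWeight_eq_sum_ite,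
      ← Finset.sum_add_distrib]
    refine Finset.sum_le_sum fun e _ => ?_
    have h0 := hw.nonneg e
    by_cases he : w e = 0
    · simp [he]
    · by_cases heU : Inside U e
      · rcases hsupp e he with h | h
        · rw [if_pos heU, if_pos (inside_inter.2 ⟨heU, h⟩)]
          split_ifs <;> linarith
        · have : Inside (U \ S) e := fun v hv =>
            Finset.mem_sdiff.2 ⟨heU v hv, fun hvS => h ⟨v, hv, hvS⟩⟩
          rw [if_pos heU, if_pos this]
          split_ifs <;> linarith
      · rw [if_neg heU]
        split_ifs <;> linarith
  have h4 : ((U ∩ S).card : ℝ) + (U \ S).card = U.card := by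
    exact_mod_cast Finset.card_inter_add_card_sdiff U S
  linarith [hU.2]

/-- A saturated vector is tight on a quarter-connected set. -/
lemma QuarterConnected.tight_of_saturated (hk : 1 ≤ k) {S : Finset V}
    (hS : QuarterConnected G k S) {w : Sym2 V → ℝ} (hw : IsSubtour G w)
    (hsupp : ∀ e, w e ≠ 0 → Inside S e ∨ ¬ Touches S e)
    (hsat : ∀ e ∈ G.edgeSet, Inside S e → w e < 8 / k → ∃ U, Tight w U ∧ Inside U e) :
    Tight w S := by
  by_contra hcon
  set 𝒬 := Finset.univ.filter fun U : Finset V => Tight w U ∧ U ⊆ S with h𝒬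
  set ℛ := roots 𝒬 with hℛ
  have hmem𝒬 : ∀ U, U ∈ 𝒬 ↔ Tight w U ∧ U ⊆ S := by intro U; simp [h𝒬]
  have hmem : ∀ P ∈ ℛ, Tight w P ∧ P ⊆ S := fun P hP => (hmem𝒬 P).1 (Finset.mem_filter.1 hP).1
  have hdisj : DisjointFamily ℛ := by
    intro P hP Q hQ hne
    rw [Finset.disjoint_iff_inter_eq_empty]
    by_contra h
    have hun := (hmem P hP).1.uncross hw (hmem Q hQ).1 (Finset.nonempty_iff_ne_empty.2 h)
    have hu : P ∪ Q ∈ 𝒬 :=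
      (hmem𝒬 _).2 ⟨hun.2.1, Finset.union_subset (hmem P hP).2 (hmem Q hQ).2⟩
    have h1 := (Finset.mem_filter.1 hP).2 _ hu Finset.subset_union_left
    have h2 := (Finset.mem_filter.1 hQ).2 _ hu Finset.subset_union_right
    exact hne (h1.trans h2.symm)
  have hcover : ℛ.biUnion id = S := by
    refine Finset.Subset.antisymm (Finset.biUnion_subset.2 fun P hP => (hmem P hP).2) fun v hv => ?_
    obtain ⟨P, hP, hvP⟩ := exists_root 𝒬 ((hmem𝒬 {v}).2
      ⟨tight_singleton hw v, Finset.singleton_subset_iff.2 hv⟩)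
    exact Finset.mem_biUnion.2 ⟨P, hP, hvP (by simp)⟩
  set B := (edges G).filter (Separated S ℛ) with hB
  have hbetween : ∀ P ∈ ℛ, edgesBetween G P (S \ P) ⊆ B.filter (Touches P) := by
    intro P hP e he
    obtain ⟨heG, heP, heS⟩ := Finset.mem_filter.1 he
    refine Finset.mem_filter.2 ⟨Finset.mem_filter.2 ⟨heG, ?_, fun Q hQ => ?_⟩, heP⟩
    · have := inside_union_of_touches Finset.disjoint_sdiff heP heS
      rwa [Finset.union_sdiff_of_subset (hmem P hP).2] at this
    · by_cases hPQ : Q = P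
      · subst hPQ
        exact not_inside_of_touches_disjoint Finset.disjoint_sdiff heS
      · exact not_inside_of_touches_disjoint (hdisj Q hQ P hP hPQ) heP
  have hcount : k * ℛ.card ≤ 8 * B.card := by
    have h1 : ∀ P ∈ ℛ, k ≤ 4 * (B.filter (Touches P)).card := by
      intro P hP
      have h := hS.2 P (hmem P hP).1.1
        ((hmem P hP).2.ssubset_of_ne fun h => hcon (h ▸ (hmem P hP).1))
      have := Finset.card_le_card (hbetween P hP)
      omega
    have h2 : ∑ P ∈ ℛ, (B.filter (Touches P)).card =
        ∑ e ∈ B, (ℛ.filter fun P => Touches P e).card :=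
      Finset.sum_card_bipartiteAbove_eq_sum_card_bipartiteBelow Touches
    have h3 : ∑ e ∈ B, (ℛ.filter fun P => Touches P e).card ≤ B.card * 2 :=
      Finset.sum_le_card_nsmul _ _ _ fun e _ => card_filter_touches_le_two hdisj e
    have h4 : ℛ.card * k ≤ ∑ P ∈ ℛ, 4 * (B.filter (Touches P)).card :=
      Finset.card_nsmul_le_sum _ _ _ h1
    rw [← Finset.mul_sum] at h4
    rw [mul_comm]
    omega
  have hkpos : (0 : ℝ) < k := by exact_mod_cast hk
  have hBw : ∀ e ∈ B, 8 / (k : ℝ) ≤ w e := by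
    intro e he
    obtain ⟨heG, heS, heP⟩ := Finset.mem_filter.1 he
    by_contra hlt
    obtain ⟨U, hU, hUe⟩ := hsat e (Finset.mem_filter.1 heG).2 heS (not_le.1 hlt)
    have hUS := hU.subset_of_inter hw hsupp (hUe.inter_nonempty heS)
    obtain ⟨P, hP, hUP⟩ := exists_root 𝒬 ((hmem𝒬 U).2 ⟨hU, hUS⟩)
    exact heP P hP (hUe.mono hUP)
  have hBsum : (ℛ.card : ℝ) ≤ ∑ e ∈ B, w e := by
    have h1 := Finset.card_nsmul_le_sum _ _ _ hBw
    rw [nsmul_eq_mul] at h1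
    refine le_trans ?_ h1
    rw [mul_div_assoc', le_div_iff₀ hkpos]
    have : (k : ℝ) * ℛ.card ≤ 8 * B.card := by exact_mod_cast hcount
    linarith
  have hins : ∑ P ∈ ℛ, insideWeight w P =
      ∑ e ∈ ℛ.biUnion fun P => Finset.univ.filter (Inside P), w e := by
    rw [Finset.sum_biUnion]
    · rfl
    · intro P hP Q hQ hne
      refine Finset.disjoint_left.2 fun e heP heQ => ?_
      exact not_inside_of_touches_disjoint (hdisj P hP Q hQ hne)
        (Finset.mem_filter.1 heQ).2.touches (Finset.mem_filter.1 heP).2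
  have hdis : Disjoint (ℛ.biUnion fun P => Finset.univ.filter (Inside P)) B := by
    refine Finset.disjoint_left.2 fun e he heB => ?_
    obtain ⟨P, hP, heP⟩ := Finset.mem_biUnion.1 he
    exact (Finset.mem_filter.1 heB).2.2 P hP (Finset.mem_filter.1 heP).2
  have hle : ∑ e ∈ (ℛ.biUnion fun P => Finset.univ.filter (Inside P)) ∪ B, w e ≤
      insideWeight w S := by
    refine Finset.sum_le_sum_of_subset_of_nonneg ?_ fun e _ _ => hw.nonneg e
    refine Finset.union_subset (Finset.biUnion_subset.2 fun P hP => ?_) fun e he => ?_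
    · exact Finset.monotone_filter_right _ fun e _ he => he.mono (hmem P hP).2
    · exact Finset.mem_filter.2 ⟨Finset.mem_univ _, (Finset.mem_filter.1 he).2.1⟩
  rw [Finset.sum_union hdis, ← hins, Finset.sum_congr rfl fun P hP => (hmem P hP).1.2,
    Finset.sum_sub_distrib] at hle
  have hcardS : ∑ P ∈ ℛ, (P.card : ℝ) = S.card := by
    have := Finset.card_biUnion (s := ℛ) (t := id) fun P hP Q hQ hne => hdisj P hP Q hQ hne
    rw [hcover] at this
    rw [this]
    push_cast
    rfl
  have := hw.le S hS.1
  rw [hcardS] at hle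
  simp only [Finset.sum_const, nsmul_eq_mul, mul_one] at hle
  linarith

/-- A laminar family of quarter-connected sets is simultaneously tight for some subtour vector
with entries at most `8 / k`. -/
lemma exists_aligned_vector (hk : 1 ≤ k) (n : ℕ) : ∀ 𝒟 : Finset (Finset V), 𝒟.card = n →
    LaminarFamily 𝒟 → (∀ S ∈ 𝒟, QuarterConnected G k S) →
      ∃ y, IsSubtour G y ∧ (∀ e, y e ≤ 8 / k) ∧ (∀ S ∈ 𝒟, Tight y S) ∧
        ∀ e, y e ≠ 0 → ∃ S ∈ 𝒟, Inside S e := by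
  induction n with
  | zero =>
    intro 𝒟 hcard _ _
    rw [Finset.card_eq_zero] at hcard
    subst hcard
    refine ⟨0, ⟨fun _ => le_rfl, fun _ _ => rfl, fun U hU => ?_⟩, fun e => ?_, by simp, by simp⟩
    · have : (1 : ℝ) ≤ U.card := by exact_mod_cast hU.card_pos
      simpa [insideWeight] using this
    · simp only [Pi.zero_apply]
      positivity
  | succ n ih =>
    intro 𝒟 hcard hlam hquart
    obtain ⟨S, hS, hmax⟩ := Finset.exists_max_image 𝒟 Finset.card
      (Finset.card_pos.1 (by omega))
    obtain ⟨y, hy, hyc, hytight, hysupp⟩ := ih (𝒟.erase S)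
      (by rw [Finset.card_erase_of_mem hS, hcard]; rfl) (hlam.mono (Finset.erase_subset _ _))
      (fun T hT => hquart T (Finset.mem_of_mem_erase hT))
    obtain ⟨w, hw, hyw, hwc, hfix, hsat⟩ := exists_saturated_extension hy hyc S
    have hsupp : ∀ e, w e ≠ 0 → ¬ Inside S e → ∃ T ∈ 𝒟.erase S, Inside T e := by
      intro e he heS
      exact hysupp e (by rwa [← hfix e heS])
    refine ⟨w, hw, hwc, fun T hT => ?_, fun e he => ?_⟩
    · by_cases hTS : T = S
      · subst hTS
        refine (hquart T hT).tight_of_saturated hk hw (fun e he => ?_) hsat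
        by_contra hcon
        push Not at hcon
        obtain ⟨R, hR, hRe⟩ := hsupp e he hcon.1
        rcases hlam R (Finset.mem_of_mem_erase hR) T hT with h | h | h
        · exact not_inside_of_touches_disjoint h hcon.2 hRe
        · exact hcon.1 (hRe.mono h)
        · refine Finset.ne_of_mem_erase hR (Finset.eq_of_subset_of_card_le h ?_).symm
          exact hmax R (Finset.mem_of_mem_erase hR)
      · have h := hytight T (Finset.mem_erase.2 ⟨hTS, hT⟩)
        refine ⟨h.1, le_antisymm (hw.le T h.1) ?_⟩
        rw [← h.2]
        exact Finset.sum_le_sum fun e _ => hyw e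
    · by_cases heS : Inside S e
      · exact ⟨S, hS, heS⟩
      · obtain ⟨T, hT, hTe⟩ := hsupp e he heS
        exact ⟨T, Finset.mem_of_mem_erase hT, hTe⟩

end StartingPoint

section IntegralTree

variable [Fintype V] {G : SimpleGraph V}

/-- The edges of weight one of an integral subtour vector tight on the vertex set form a
spanning tree. -/
lemma exists_tree_of_integral {t : Sym2 V → ℝ} (ht : IsSubtour G t)
    (hV : Tight t Finset.univ) (h01 : ∀ e, t e = 0 ∨ t e = 1) :
    ∃ T : SimpleGraph V, T ≤ G ∧ T.IsTree ∧ ∀ e, e ∈ T.edgeSet ↔ t e = 1 := by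
  have hG : ∀ e, t e = 1 → e ∈ G.edgeSet := by
    intro e he
    by_contra h
    rw [ht.support e h] at he
    exact zero_ne_one he
  set T := SimpleGraph.fromEdgeSet {e | t e = 1} with hT
  have hTG : T ≤ G := by
    intro u v huv
    rw [hT, SimpleGraph.fromEdgeSet_adj] at huv
    exact hG _ huv.1
  have hedge : ∀ e, e ∈ T.edgeSet ↔ t e = 1 := by
    intro e
    rw [hT, SimpleGraph.edgeSet_fromEdgeSet]
    exact ⟨fun h => h.1, fun h => ⟨h, G.not_isDiag_of_mem_edgeSet (hG e h)⟩⟩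
  refine ⟨T, hTG, SimpleGraph.isTree_iff_connected_and_card.2 ⟨?_, ?_⟩, hedge⟩
  · obtain ⟨u, -⟩ := hV.1
    rw [SimpleGraph.connected_iff_exists_forall_reachable]
    refine ⟨u, fun v => ?_⟩
    by_contra hv
    set A : Finset V := Finset.univ.filter fun w => T.Reachable u w with hA
    have hmemA : ∀ w, w ∈ A ↔ T.Reachable u w := by intro w; simp [hA]
    have h1 := ht.le A ⟨u, (hmemA u).2 (SimpleGraph.Reachable.refl u)⟩
    have h2 := ht.le Aᶜ ⟨v, Finset.mem_compl.2 fun h => hv ((hmemA v).1 h)⟩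
    have h3 : insideWeight t Finset.univ ≤ insideWeight t A + insideWeight t Aᶜ := by
      rw [insideWeight_eq_sum_ite, insideWeight_eq_sum_ite, insideWeight_eq_sum_ite,
        ← Finset.sum_add_distrib]
      refine Finset.sum_le_sum fun e _ => ?_
      rcases h01 e with h0 | h1
      · simp [h0]
      · have hor : Inside A e ∨ Inside Aᶜ e := by
          induction e using Sym2.ind with
          | _ a b =>
            have hadj : T.Adj a b := (hedge _).2 h1
            rw [inside_mk, inside_mk, Finset.mem_compl, Finset.mem_compl, hmemA, hmemA]
            by_cases ha : T.Reachable u a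
            · exact Or.inl ⟨ha, ha.trans hadj.reachable⟩
            · exact Or.inr ⟨ha, fun hb => ha (hb.trans hadj.symm.reachable)⟩
        rw [if_pos (inside_univ e), h1]
        rcases hor with h | h <;> rw [if_pos h] <;> split_ifs <;> norm_num
    have h4 : (A.card : ℝ) + (Aᶜ).card = (Finset.univ : Finset V).card := by
      exact_mod_cast Finset.card_add_card_compl A
    linarith [hV.2]
  · have h1 : insideWeight t Finset.univ = (T.edgeFinset.card : ℝ) := by
      rw [insideWeight_eq_sum_ite, Finset.card_eq_sum_ones, Nat.cast_sum]
      have : T.edgeFinset = Finset.univ.filter fun e => t e = 1 := by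
        ext e; simp [hedge]
      rw [this, Finset.sum_filter]
      refine Finset.sum_congr rfl fun e _ => ?_
      rw [if_pos (inside_univ e)]
      rcases h01 e with h | h <;> simp [h]
    have h2 := hV.2
    rw [h1, Finset.card_univ] at h2
    rw [Nat.card_eq_fintype_card, Nat.card_eq_fintype_card, ← SimpleGraph.edgeFinset_card]
    have h3 : (T.edgeFinset.card : ℝ) + 1 = Fintype.card V := by linarith
    exact_mod_cast h3

end IntegralTree

lemma cutEdges_eq_cut [Fintype V] (G : SimpleGraph V) (S : Finset V) :
    cutEdges G (S : Set V) = cut G S := by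
  ext e
  simp only [cutEdges, cut, edges, Finset.mem_filter, Finset.mem_univ, true_and]
  refine and_congr_right fun _ => ?_
  constructor
  · rintro ⟨u, v, rfl, hu, hv⟩
    exact ⟨touches_mk.2 (Or.inl hu), fun h => hv (inside_mk.1 h).2⟩
  · intro h
    induction e using Sym2.ind with
    | _ a b =>
      rw [Crosses, touches_mk, inside_mk] at h
      by_cases ha : a ∈ S
      · exact ⟨a, b, rfl, ha, fun hb => h.2 ⟨ha, hb⟩⟩
      · exact ⟨b, a, Sym2.eq_swap, h.1.resolve_left ha, ha⟩

/-- The edges of `F` crossing `S` are covered by those crossing the components of `S`. -/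
lemma card_filter_crosses_le_components [Fintype V] (F : Finset (Sym2 V)) (G : SimpleGraph V)
    (k : ℕ) (S : Finset V) :
    (F.filter (Crosses S)).card ≤ ∑ C ∈ components G k S, (F.filter (Crosses C)).card := by
  refine le_trans (Finset.card_le_card fun e he => ?_) Finset.card_biUnion_le
  obtain ⟨heF, ⟨v, hv, hvS⟩, hin⟩ := Finset.mem_filter.1 he
  obtain ⟨C, hC, hvC⟩ := exists_mem_component (G := G) (k := k) hvS
  exact Finset.mem_biUnion.2 ⟨C, hC, Finset.mem_filter.2 ⟨heF, ⟨v, hv, hvC⟩,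
    fun h => hin (h.mono (mem_components.1 hC).1.2)⟩⟩

/-- Thin trees for laminar families of vertex sets, with an explicit constant. -/
theorem exists_thin_tree [Fintype V] [Nonempty V] {k : ℕ} (hk : 1 ≤ k) (G : SimpleGraph V)
    (hconn : ∀ S : Finset V, S.Nonempty → S ≠ Finset.univ → k ≤ (cut G S).card)
    {𝓛 : Finset (Finset V)} (hlam : LaminarFamily 𝓛)
    (hne : ∀ S ∈ 𝓛, S.Nonempty ∧ S ≠ Finset.univ) :
    ∃ T : SimpleGraph V, T ≤ G ∧ T.IsTree ∧ ∀ S ∈ 𝓛,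
      ((T.edgeFinset ∩ cut G S).card : ℝ) ≤ 28 / k * (cut G S).card := by
  have hkpos : (0 : ℝ) < k := by exact_mod_cast hk
  set 𝓒 := 𝓛.biUnion (components G k) with h𝓒
  have hlamF : LaminarFamily (insert Finset.univ 𝓒) := by
    have h𝓒l : LaminarFamily 𝓒 := hlam.components
    intro S hS T hT
    rcases Finset.mem_insert.1 hS with rfl | hS'
    · exact Or.inr (Or.inr (Finset.subset_univ _))
    · rcases Finset.mem_insert.1 hT with rfl | hT'
      · exact Or.inr (Or.inl (Finset.subset_univ _))
      · exact h𝓒l S hS' T hT'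
  have hquart : ∀ S ∈ insert Finset.univ 𝓒, QuarterConnected G k S := by
    intro S hS
    rcases Finset.mem_insert.1 hS with rfl | hS
    · exact quarterConnected_univ hconn
    · obtain ⟨R, -, hSR⟩ := Finset.mem_biUnion.1 hS
      exact (mem_components.1 hSR).1.1
  obtain ⟨x, hx, hxk, hxtight, -⟩ := exists_aligned_vector hk _ _ rfl hlamF hquart
  obtain ⟨t, ht, httight, ht01, -, htcut⟩ := exists_integral_rounding
    (Finset.mem_insert_self _ _) hlamF (fun S => ⌈cutWeight x S⌉) _ 𝓒 x rfl
    (Finset.subset_insert _ _) hx hxtight (fun S _ => Int.le_ceil _)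
  obtain ⟨T, hTG, hTtree, hTe⟩ := exists_tree_of_integral ht
    (httight _ (Finset.mem_insert_self _ _)) ht01
  refine ⟨T, hTG, hTtree, fun S hS => ?_⟩
  have hxcut : ∀ C : Finset V, cutWeight x C ≤ 8 / k * (cut G C).card := by
    intro C
    have h1 : cutWeight x C = ∑ e ∈ cut G C, x e := by
      refine (Finset.sum_subset (Finset.filter_subset_filter _ (Finset.subset_univ _)) ?_).symm
      intro e he he'
      refine hx.support e fun h => he' (Finset.mem_filter.2 ⟨?_, (Finset.mem_filter.1 he).2⟩)
      simp [edges, h]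
    rw [h1, mul_comm, ← nsmul_eq_mul]
    exact Finset.sum_le_card_nsmul _ _ _ fun e _ => hxk e
  have hTcut : ∀ C : Finset V, ((T.edgeFinset.filter (Crosses C)).card : ℝ) = cutWeight t C := by
    intro C
    have : T.edgeFinset.filter (Crosses C) =
        (Finset.univ.filter (Crosses C)).filter fun e => t e = 1 := by
      ext e; simp [hTe, and_comm]
    rw [this, Finset.card_filter, Nat.cast_sum, cutWeight]
    refine Finset.sum_congr rfl fun e _ => ?_
    rcases ht01 e with h | h <;> simp [h]
  have hcomp : ∀ C ∈ components G k S,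
      ((T.edgeFinset.filter (Crosses C)).card : ℝ) ≤ 8 / k * (cut G C).card + 6 := by
    intro C hC
    have h1 := htcut C (Finset.mem_biUnion.2 ⟨S, hS, hC⟩)
    have h2 := (Int.ceil_lt_add_one (cutWeight x C)).le
    have h3 := hxcut C
    rw [hTcut]
    linarith
  have hinter : T.edgeFinset ∩ cut G S = T.edgeFinset.filter (Crosses S) := by
    ext e
    simp only [cut, edges, Finset.mem_inter, Finset.mem_filter, Finset.mem_univ, true_and,
      SimpleGraph.mem_edgeFinset]
    exact ⟨fun h => ⟨h.1, h.2.2⟩, fun h => ⟨h.1, SimpleGraph.edgeSet_mono hTG h.1, h.2⟩⟩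
  have hsum : ((T.edgeFinset.filter (Crosses S)).card : ℝ) ≤
      ∑ C ∈ components G k S, (8 / k * ((cut G C).card : ℝ) + 6) := by
    refine le_trans ?_ (Finset.sum_le_sum hcomp)
    exact_mod_cast card_filter_crosses_le_components T.edgeFinset G k S
  obtain ⟨hb1, hb2⟩ := components_bounds hconn (hne S hS).1 (hne S hS).2
  have hb1' : ∑ C ∈ components G k S, ((cut G C).card : ℝ) ≤ 2 * (cut G S).card := by
    exact_mod_cast hb1
  have hb2' : (k : ℝ) * (components G k S).card ≤ 2 * (cut G S).card := by exact_mod_cast hb2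
  rw [hinter]
  refine hsum.trans ?_
  rw [Finset.sum_add_distrib, ← Finset.mul_sum, Finset.sum_const, nsmul_eq_mul,
    div_mul_eq_mul_div, div_mul_eq_mul_div, div_add' _ _ _ hkpos.ne',
    div_le_div_iff_of_pos_right hkpos]
  linarith

/-- Thin trees for laminar families in `k`-edge-connected graphs. -/
theorem laminar_thin_tree_of_edgeConnected [Fintype V] (k : ℕ) (hk : 1 ≤ k)
    (G : SimpleGraph V) (hG : G.Connected)
    (hconn : ∀ S : Set V, S.Nonempty → S ≠ Set.univ → k ≤ (cutEdges G S).card)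
    (L : Set (Set V)) (hL : Laminar L)
    (hLne : ∀ S ∈ L, S.Nonempty ∧ S ≠ Set.univ) :
    ∃ T : SimpleGraph V, T ≤ G ∧ T.IsTree ∧
      ∀ S ∈ L, ((T.edgeFinset ∩ cutEdges G S).card : ℝ) ≤
          (2 * (2 + Real.sqrt 7) ^ 2 / k) * (cutEdges G S).card ∧
        ((T.edgeFinset ∩ cutEdges G S).card : ℝ) ≤ (44 / k) * (cutEdges G S).card := by
  have hne : Nonempty V := hG.nonempty
  obtain ⟨T, hTG, hTtree, hT⟩ := exists_thin_tree hk G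
    (fun S hS hSu => by
      rw [← cutEdges_eq_cut]
      exact hconn S (by simpa using hS) (by simpa using hSu))
    (𝓛 := Finset.univ.filter fun S : Finset V => (S : Set V) ∈ L)
    (fun S hS T hT => by
      simp only [Finset.mem_filter, Finset.mem_univ, true_and] at hS hT
      have h := hL S T hS hT
      rw [← Finset.coe_inter] at h
      rcases h with h | h | h
      · exact Or.inl (Finset.disjoint_iff_inter_eq_empty.2 (by exact_mod_cast h))
      · exact Or.inr (Or.inl (Finset.inter_eq_left.1 (by exact_mod_cast h)))
      · exact Or.inr (Or.inr (Finset.inter_eq_right.1 (by exact_mod_cast h))))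
    (fun S hS => by
      simp only [Finset.mem_filter, Finset.mem_univ, true_and] at hS
      simpa using hLne S hS)
  refine ⟨T, hTG, hTtree, fun S hS => ?_⟩
  have h := hT S.toFinset (by simpa using hS)
  rw [← cutEdges_eq_cut, Set.coe_toFinset] at h
  have h7 : 2 ≤ Real.sqrt 7 := by
    rw [Real.le_sqrt (by norm_num) (by norm_num)]
    norm_num
  refine ⟨h.trans ?_, h.trans ?_⟩ <;> gcongr
  · nlinarith
  · norm_num
end
end

section
/- For every integer k ≥ 1 and every finite connected k-edge-connected graph G=(V,E) (i.e., |δ(S)| ≥ k for every nonempty proper subset S ⊂ V), there exists a point x in the spanning tree polytope of G with x(e) ≤ 2/k for every edge e ∈ E. -/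
open scoped Classical
open Finset

noncomputable section

variable {V : Type}

/-- A nonempty compact convex set contains a point of minimal Euclidean norm; it satisfies the
variational inequality of a projection of the origin. -/
lemma exists_forall_sum_mul_self_le {ι : Type*} [Fintype ι] {K : Set (ι → ℝ)}
    (hK : IsCompact K) (hconv : Convex ℝ K) (hne : K.Nonempty) :
    ∃ x ∈ K, ∀ y ∈ K, ∑ i, x i * x i ≤ ∑ i, x i * y i := by
  obtain ⟨x, hx, hmin⟩ := hK.exists_isMinOn hne
    (f := fun x : ι → ℝ => ∑ i, x i * x i) (by fun_prop)
  refine ⟨x, hx, fun y hy => ?_⟩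
  have key : ∀ t : ℝ, 0 < t → t ≤ 1 →
      0 ≤ 2 * ((∑ i, x i * y i) - ∑ i, x i * x i) + t * ∑ i, (y i - x i) * (y i - x i) := by
    intro t ht ht1
    have hmem : x + t • (y - x) ∈ K := hconv.add_smul_sub_mem hx hy ⟨ht.le, ht1⟩
    have hle : ∑ i, x i * x i ≤ ∑ i, (x + t • (y - x)) i * (x + t • (y - x)) i := hmin hmem
    have hexp : ∑ i, (x + t • (y - x)) i * (x + t • (y - x)) i = ∑ i, x i * x i +
        t * (2 * ((∑ i, x i * y i) - ∑ i, x i * x i) + t * ∑ i, (y i - x i) * (y i - x i)) := by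
      simp only [Finset.mul_sum, mul_add, ← Finset.sum_add_distrib, ← Finset.sum_sub_distrib]
      refine Finset.sum_congr rfl fun i _ => ?_
      simp only [Pi.add_apply, Pi.smul_apply, Pi.sub_apply, smul_eq_mul]
      ring
    rw [hexp] at hle
    exact nonneg_of_mul_nonneg_right (by linarith) ht
  by_contra! hlt
  set a := (∑ i, x i * x i) - ∑ i, x i * y i with ha
  have ha0 : 0 < a := sub_pos.2 hlt
  have hb0 : 0 ≤ ∑ i, (y i - x i) * (y i - x i) :=
    Finset.sum_nonneg fun i _ => mul_self_nonneg _
  set b := ∑ i, (y i - x i) * (y i - x i) with hb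
  have hpos : 0 < a + b := by linarith
  have h := key (a / (a + b)) (by positivity) ((div_le_one hpos).2 (by linarith))
  have hab : a / (a + b) * b ≤ a := by
    rw [div_mul_eq_mul_div, div_le_iff₀ hpos]
    nlinarith
  linarith

namespace SimpleGraph

/-- The spanning-tree exchange: adding a non-edge and deleting an edge of the path it closes up
preserves connectedness. -/
lemma Connected.deleteEdges_sup_edge_of_mem_path {T : SimpleGraph V} (hT : T.Connected) {u v : V}
    (huv : u ≠ v) (hadj : ¬ T.Adj u v) {p : T.Walk u v} (hp : p.IsPath) {f : Sym2 V}
    (hf : f ∈ p.edges) : ((T ⊔ edge u v).deleteEdges {f}).Connected := by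
  have hle : T ≤ T ⊔ edge u v := le_sup_left
  have hvu : (T ⊔ edge u v).Adj v u := by simp [edge_adj, huv, huv.symm]
  have hcyc : (Walk.cons hvu (p.mapLe hle)).IsCycle := by
    rw [Walk.cons_isCycle_iff]
    refine ⟨(Walk.isPath_mapLe hle).2 hp, fun h => hadj ?_⟩
    rw [Walk.edges_mapLe_eq_edges] at h
    exact (p.adj_of_mem_edges h).symm
  have hfc : f ∈ (Walk.cons hvu (p.mapLe hle)).edges := by
    rw [Walk.edges_cons, Walk.edges_mapLe_eq_edges]
    exact List.mem_cons_of_mem _ hf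
  induction f with
  | h a b =>
    exact (hT.mono hle).connected_delete_edge_of_not_isBridge
      fun hb => hb.notMem_edges_of_isCycle hcyc hfc

/-- Trees of minimal weight span every strict sublevel graph of the weight. -/
lemma reachable_inf_of_forall_weight_le [Fintype V] {G H T : SimpleGraph V} {x : Sym2 V → ℝ}
    (hx : ∀ e, 0 ≤ x e) (hTG : T ≤ G) (hT : T.IsTree)
    (hmin : ∀ T' : SimpleGraph V, T' ≤ G → T'.IsTree →
      ∑ e, x e * (if e ∈ T.edgeSet then (1 : ℝ) else 0) ≤
        ∑ e, x e * (if e ∈ T'.edgeSet then (1 : ℝ) else 0))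
    (hHG : H ≤ G) (hH : ∀ e ∈ H.edgeSet, ∀ f ∈ G.edgeSet, f ∉ H.edgeSet → x e < x f)
    {u v : V} (huv : H.Adj u v) : (T ⊓ H).Reachable u v := by
  by_contra hreach
  have hadj : ¬ T.Adj u v := fun h => hreach (Adj.reachable ⟨h, huv⟩)
  obtain ⟨p, hp⟩ := hT.connected.exists_isPath u v
  obtain ⟨f, hfp, hfH⟩ : ∃ f ∈ p.edges, f ∉ H.edgeSet := by
    by_contra! hall
    refine hreach ⟨p.transfer (T ⊓ H) fun e he => ?_⟩
    rw [edgeSet_inf]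
    exact ⟨p.edges_subset_edgeSet he, hall e he⟩
  have hfT : f ∈ T.edgeSet := p.edges_subset_edgeSet hfp
  obtain ⟨T', hT'le, hT'⟩ :=
    (hT.connected.deleteEdges_sup_edge_of_mem_path huv.ne hadj hp hfp).exists_isTree_le
  have hT'e : ∀ e ∈ T'.edgeSet, (e ∈ T.edgeSet ∨ e = s(u, v)) ∧ e ≠ f := by
    intro e he
    have := edgeSet_mono hT'le he
    rw [edgeSet_deleteEdges, edgeSet_sup, edgeSet_edge_of_ne huv.ne] at this
    simpa only [Set.mem_sdiff, Set.mem_union, Set.mem_singleton_iff] using this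
  have hT'G : T' ≤ G := by
    rw [← edgeSet_subset_edgeSet]
    intro e he
    rcases (hT'e e he).1 with h | rfl
    · exact edgeSet_mono hTG h
    · exact hHG huv
  have hlt := hH s(u, v) huv f (edgeSet_mono hTG hfT) hfH
  have hsum : ∑ e, x e * (if e ∈ T'.edgeSet then (1 : ℝ) else 0) ≤
      ∑ e, (x e * (if e ∈ T.edgeSet then (1 : ℝ) else 0) +
        x e * (if e = s(u, v) then 1 else 0) - x e * (if e = f then 1 else 0)) := by
    refine Finset.sum_le_sum fun e _ => ?_
    rw [← mul_add, ← mul_sub]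
    refine mul_le_mul_of_nonneg_left ?_ (hx e)
    have h := hT'e e
    split_ifs <;> simp_all
  have := hmin T' hT'G hT'
  simp only [Finset.sum_sub_distrib, Finset.sum_add_distrib, mul_ite, mul_one, mul_zero,
    Finset.sum_ite_eq', Finset.mem_univ, if_true] at hsum this
  linarith

/-- A graph whose reachability contains that of `H` has at least `|V| - c(H)` edges. -/
lemma card_le_ncard_edgeSet_add_card_connectedComponent [Fintype V] [Nonempty V]
    {J H : SimpleGraph V} (h : ∀ u v, H.Adj u v → J.Reachable u v) :
    Fintype.card V ≤ J.edgeSet.ncard + Fintype.card H.ConnectedComponent := by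
  have hreach : ∀ u v, H.Reachable u v → J.Reachable u v := by
    rintro u v ⟨p⟩
    induction p with
    | nil => rfl
    | cons huv _ ih => exact (h _ _ huv).trans ih
  obtain ⟨r⟩ := ‹Nonempty V›
  let rep : H.ConnectedComponent → V := Quot.out
  have hrep : ∀ c, H.connectedComponentMk (rep c) = c := Quot.out_eq
  let c₀ := H.connectedComponentMk r
  let S : Set (Sym2 V) := (fun c => s(rep c₀, rep c)) '' {c₀}ᶜ
  let K := J ⊔ fromEdgeSet S
  have hK : K.Connected := by
    rw [connected_iff_exists_forall_reachable]
    refine ⟨rep c₀, fun v => ?_⟩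
    have hv : K.Reachable (rep (H.connectedComponentMk v)) v :=
      (hreach _ _ (ConnectedComponent.exact (hrep _))).mono le_sup_left
    refine Reachable.trans ?_ hv
    by_cases hc : H.connectedComponentMk v = c₀
    · rw [hc]
    · refine Adj.reachable (Or.inr ?_)
      rw [fromEdgeSet_adj]
      refine ⟨⟨_, hc, rfl⟩, fun heq => hc ?_⟩
      rw [← hrep (H.connectedComponentMk v), ← heq, hrep]
  have hcard := hK.card_vert_le_card_edgeSet_add_one
  have hS : S.ncard ≤ Fintype.card H.ConnectedComponent - 1 := by
    refine (Set.ncard_image_le (Set.toFinite _)).trans ?_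
    rw [Set.ncard_compl, Set.ncard_singleton, Nat.card_eq_fintype_card]
  have hKe : K.edgeSet.ncard ≤ J.edgeSet.ncard + S.ncard := by
    refine (Set.ncard_le_ncard ?_ (Set.toFinite _)).trans (Set.ncard_union_le _ _)
    rw [edgeSet_sup]
    exact Set.union_subset_union_right _ (by simp [edgeSet_fromEdgeSet])
  have hpos : 0 < Fintype.card H.ConnectedComponent := Fintype.card_pos_iff.2 ⟨c₀⟩
  rw [Nat.card_eq_fintype_card, Nat.card_coe_set_eq] at hcard
  omega

/-- A spanning tree that spans every component of `H` has fewer than `c(H)` edges outside `H`. -/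
lemma IsTree.ncard_edgeSet_diff_lt [Fintype V] {T H : SimpleGraph V} (hT : T.IsTree)
    (h : ∀ u v, H.Adj u v → (T ⊓ H).Reachable u v) :
    (T.edgeSet \ H.edgeSet).ncard < Fintype.card H.ConnectedComponent := by
  have := hT.connected.nonempty
  have hJ := card_le_ncard_edgeSet_add_card_connectedComponent h
  have hcard := hT.card_edgeFinset
  rw [SimpleGraph.edgeFinset, ← Set.ncard_eq_toFinset_card'] at hcard
  have hsplit := Set.ncard_inter_add_ncard_sdiff_eq_ncard T.edgeSet H.edgeSet (Set.toFinite _)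
  rw [edgeSet_inf] at hJ
  omega

end SimpleGraph

/-- Double counting of the edges of `G` joining different components of a subgraph `H`. -/
lemma mul_card_connectedComponent_le [Fintype V] {k : ℕ} {G H : SimpleGraph V}
    (hconn : ∀ S : Set V, S.Nonempty → S ≠ Set.univ → k ≤ (cutEdges G S).card)
    (hc : 1 < Fintype.card H.ConnectedComponent) :
    k * Fintype.card H.ConnectedComponent ≤
      2 * #{e : Sym2 V | e ∈ G.edgeSet ∧ e ∉ H.edgeSet} := by
  have hcut : ∀ c : H.ConnectedComponent, k ≤ (cutEdges G c.supp).card := by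
    intro c
    refine hconn _ c.nonempty_supp fun hu => ?_
    obtain ⟨c', hc'⟩ := Fintype.exists_ne_of_one_lt_card hc c
    obtain ⟨v, hv⟩ := c'.nonempty_supp
    have hv' : v ∈ c.supp := hu ▸ Set.mem_univ v
    exact hc' (hv.symm.trans hv')
  have hsub : ∀ c : H.ConnectedComponent, cutEdges G c.supp ⊆
      ({e : Sym2 V | e ∈ G.edgeSet ∧ e ∉ H.edgeSet} : Finset (Sym2 V)) := by
    intro c e he
    simp only [cutEdges, Finset.mem_filter, Finset.mem_univ, true_and] at he ⊢
    obtain ⟨heG, u, v, rfl, hu, hv⟩ := he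
    exact ⟨heG, fun huv => hv (c.mem_supp_of_adj_mem_supp hu huv)⟩
  have htwo : ∀ e : Sym2 V,
      #{c : H.ConnectedComponent | e ∈ cutEdges G c.supp} ≤ 2 := by
    intro e
    induction e with
    | h a b =>
      refine (Finset.card_le_card (t := {H.connectedComponentMk a, H.connectedComponentMk b})
        fun c hc => ?_).trans Finset.card_le_two
      simp only [cutEdges, Finset.mem_filter, Finset.mem_univ, true_and] at hc
      obtain ⟨-, u, v, huv, hu, -⟩ := hc
      have hu' : H.connectedComponentMk u = c := hu
      rcases Sym2.eq_iff.1 huv with ⟨rfl, rfl⟩ | ⟨rfl, rfl⟩ <;> simp [hu']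
  calc k * Fintype.card H.ConnectedComponent
      ≤ ∑ c : H.ConnectedComponent, (cutEdges G c.supp).card := by
        rw [mul_comm, ← smul_eq_mul, ← Finset.card_univ]
        exact Finset.card_nsmul_le_sum _ _ _ fun c _ => hcut c
    _ = ∑ c : H.ConnectedComponent, ∑ e : Sym2 V with e ∈ G.edgeSet ∧ e ∉ H.edgeSet,
          if e ∈ cutEdges G c.supp then 1 else 0 := by
        refine Finset.sum_congr rfl fun c _ => ?_
        rw [← Finset.sum_filter, Finset.sum_const, smul_eq_mul, mul_one,
          Finset.filter_mem_eq_inter, Finset.inter_eq_right.2 (hsub c)]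
    _ = ∑ e : Sym2 V with e ∈ G.edgeSet ∧ e ∉ H.edgeSet,
          #{c : H.ConnectedComponent | e ∈ cutEdges G c.supp} := by
        rw [Finset.sum_comm]
        simp only [Finset.card_filter]
    _ ≤ 2 * #{e : Sym2 V | e ∈ G.edgeSet ∧ e ∉ H.edgeSet} := by
        rw [mul_comm, ← smul_eq_mul]
        exact Finset.sum_le_card_nsmul _ _ _ fun e _ => htwo e

/-- `k`-edge-connected graphs admit a fractional spanning tree with all
coordinates at most `2/k`. -/
theorem exists_fractional_tree_le_two_div_k [Fintype V] (k : ℕ) (hk : 1 ≤ k)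
    (G : SimpleGraph V) (hG : G.Connected)
    (hconn : ∀ S : Set V, S.Nonempty → S ≠ Set.univ → k ≤ (cutEdges G S).card) :
    ∃ x ∈ stPolytope G, ∀ e ∈ G.edgeSet, x e ≤ 2 / k := by
  have hfin : { y : Sym2 V → ℝ | ∃ T : SimpleGraph V, T ≤ G ∧ T.IsTree ∧
      y = fun e => if e ∈ T.edgeSet then (1 : ℝ) else 0 }.Finite := by
    refine (Set.finite_range fun T : SimpleGraph V =>
      fun e : Sym2 V => if e ∈ T.edgeSet then (1 : ℝ) else 0).subset ?_
    rintro y ⟨T, -, -, rfl⟩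
    exact ⟨T, rfl⟩
  have hmem : ∀ T : SimpleGraph V, T ≤ G → T.IsTree →
      (fun e => if e ∈ T.edgeSet then (1 : ℝ) else 0) ∈ stPolytope G :=
    fun T hTG hT => subset_convexHull ℝ _ ⟨T, hTG, hT, rfl⟩
  obtain ⟨x, hxP, hxmin⟩ := exists_forall_sum_mul_self_le
    (K := stPolytope G) (hfin.isCompact_convexHull ℝ) (convex_convexHull ℝ _) (by
      obtain ⟨T, hTG, hT⟩ := hG.exists_isTree_le
      exact ⟨_, hmem T hTG hT⟩)
  refine ⟨x, hxP, ?_⟩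
  obtain ⟨ι, _, w, z, hw0, hw1, hz, hxz⟩ := (mem_convexHull_iff_exists_fintype (R := ℝ)).1 hxP
  choose T hTG hT hzT using hz
  have hxe : ∀ e, x e = ∑ i, w i * z i e := fun e => by
    rw [← hxz]; simp [Finset.sum_apply]
  have hx0 : ∀ e, 0 ≤ x e := fun e => by
    rw [hxe]
    refine Finset.sum_nonneg fun i _ => mul_nonneg (hw0 i) ?_
    rw [hzT]
    dsimp only
    split_ifs <;> norm_num
  -- every tree in the support of `x` has minimal `x`-weight
  have hsupp : ∀ i, 0 < w i → ∑ e, x e * z i e = ∑ e, x e * x e := by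
    have hge : ∀ i, ∑ e, x e * x e ≤ ∑ e, x e * z i e := fun i =>
      hxmin _ (hzT i ▸ hmem (T i) (hTG i) (hT i))
    have hsum : ∑ i, w i * ((∑ e, x e * z i e) - ∑ e, x e * x e) = 0 := by
      have h : ∑ i, w i * ∑ e, x e * z i e = ∑ e, x e * x e := by
        simp only [Finset.mul_sum]
        rw [Finset.sum_comm]
        refine Finset.sum_congr rfl fun e _ => ?_
        nth_rewrite 3 [hxe e]
        rw [Finset.mul_sum]
        exact Finset.sum_congr rfl fun i _ => by ring
      simp only [mul_sub, Finset.sum_sub_distrib, ← Finset.sum_mul, hw1, h, one_mul, sub_self]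
    intro i hi
    have h := (Finset.sum_eq_zero_iff_of_nonneg fun i _ =>
      mul_nonneg (hw0 i) (sub_nonneg.2 (hge i))).1 hsum i (Finset.mem_univ i)
    exact sub_eq_zero.1 ((mul_eq_zero.1 h).resolve_left hi.ne')
  by_contra! hbad
  obtain ⟨e₁, he₁, hlt₁⟩ := hbad
  obtain ⟨e₀, he₀, hmax⟩ := G.edgeFinset.exists_max_image x ⟨e₁, by simpa using he₁⟩
  simp only [SimpleGraph.mem_edgeFinset] at he₀ hmax
  have hlt : 2 / (k : ℝ) < x e₀ := hlt₁.trans_le (hmax _ he₁)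
  obtain ⟨H, hHG, hHe⟩ : ∃ H ≤ G, ∀ e, e ∈ H.edgeSet ↔ e ∈ G.edgeSet ∧ x e ≠ x e₀ :=
    ⟨G.deleteEdges {e | x e = x e₀}, G.deleteEdges_le _, fun e => by
      simp [SimpleGraph.edgeSet_deleteEdges]⟩
  let F : Finset (Sym2 V) := {e : Sym2 V | e ∈ G.edgeSet ∧ e ∉ H.edgeSet}
  have hF : ∀ e, e ∈ F ↔ e ∈ G.edgeSet ∧ x e = x e₀ := fun e => by
    simp only [F, Finset.mem_filter, Finset.mem_univ, true_and, hHe]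
    tauto
  have hbound : ∀ i, 0 < w i → ∑ e ∈ F, z i e ≤ (Fintype.card H.ConnectedComponent : ℝ) - 1 := by
    intro i hi
    have hspan : ∀ u v, H.Adj u v → (T i ⊓ H).Reachable u v := fun u v huv => by
      refine SimpleGraph.reachable_inf_of_forall_weight_le hx0 (hTG i) (hT i) ?_
        hHG ?_ huv
      · intro T' hT'G hT'
        have h := hsupp i hi
        rw [hzT] at h
        rw [h]
        exact hxmin _ (hmem T' hT'G hT')
      · intro e he f hf hfH
        have hfx := ((hF f).1 (by simpa [F] using ⟨hf, hfH⟩)).2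
        rw [hHe] at he
        exact hfx ▸ (hmax e he.1).lt_of_ne he.2
    have hcard := (hT i).ncard_edgeSet_diff_lt hspan
    have hFi : ∑ e ∈ F, z i e = ((T i).edgeSet \ H.edgeSet).ncard := by
      rw [hzT, Finset.sum_boole, Set.ncard_eq_toFinset_card']
      congr 2
      ext e
      have := @SimpleGraph.edgeSet_mono _ _ _ (hTG i) e
      simp only [F, Finset.mem_filter, Finset.mem_univ, true_and, Set.mem_toFinset, Set.mem_sdiff]
      tauto
    rw [hFi, le_sub_iff_add_le]
    exact_mod_cast Nat.succ_le_of_lt hcard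
  have hxF : #F * x e₀ ≤ (Fintype.card H.ConnectedComponent : ℝ) - 1 := by
    calc #F * x e₀ = ∑ e ∈ F, x e := by
          rw [Finset.sum_congr rfl fun e he => ((hF e).1 he).2, Finset.sum_const, nsmul_eq_mul]
      _ = ∑ i, w i * ∑ e ∈ F, z i e := by
          simp only [hxe, Finset.mul_sum]
          exact Finset.sum_comm
      _ ≤ ∑ i, w i * ((Fintype.card H.ConnectedComponent : ℝ) - 1) := by
          refine Finset.sum_le_sum fun i _ => ?_
          rcases (hw0 i).eq_or_lt with h | h
          · simp [← h]
          · exact mul_le_mul_of_nonneg_left (hbound i h) h.le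
      _ = (Fintype.card H.ConnectedComponent : ℝ) - 1 := by
          rw [← Finset.sum_mul, hw1, one_mul]
  have hk0 : (0 : ℝ) < k := by exact_mod_cast hk
  have hx₀ : 0 < x e₀ := lt_of_le_of_lt (by positivity) hlt
  have hFpos : (0 : ℝ) < #F := by
    exact_mod_cast Finset.card_pos.2 ⟨e₀, (hF e₀).2 ⟨he₀, rfl⟩⟩
  have hc : 1 < Fintype.card H.ConnectedComponent := by
    have : (1 : ℝ) < Fintype.card H.ConnectedComponent := by linarith [mul_pos hFpos hx₀]
    exact_mod_cast this
  have hcount : (k : ℝ) * Fintype.card H.ConnectedComponent ≤ 2 * #F := by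
    exact_mod_cast mul_card_connectedComponent_le hconn hc
  rw [div_lt_iff₀ hk0] at hlt
  have hlow := mul_lt_mul_of_pos_left hlt hFpos
  have hupp := mul_le_mul_of_nonneg_left hxF hk0.le
  linarith
end
end

section
/- Let G=(V,E) be a finite graph, let x : E → ℝ≥0, and let η > 0. Let P be a partition of V into nonempty parts that minimizes η·x(δ(P)) − (|P| − 1) over all partitions of V into nonempty parts. Then every part P ∈ P is η-well-connected with respect to x: for every partition Q of P into nonempty parts, η·x(δ_{G[P]}(Q)) ≥ |Q| − 1. -/
open scoped Classical
open Finset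

noncomputable section

variable {V : Type}

/-- `P` is a partition of `S` into (pairwise disjoint) nonempty parts. -/
def IsPartitionOf (S : Set V) (P : Finset (Set V)) : Prop :=
  (∀ p ∈ P, p.Nonempty) ∧ ((P : Set (Set V)).Pairwise Disjoint) ∧ (⋃ p ∈ P, p) = S

/-- The set of edges of `G` whose two endpoints lie in two different parts of `P`. -/
def partitionCut [Fintype V] (G : SimpleGraph V) (P : Finset (Set V)) : Finset (Sym2 V) :=
  Finset.univ.filter (fun e => e ∈ G.edgeSet ∧
    ∃ u v, e = s(u, v) ∧ ∃ p ∈ P, ∃ q ∈ P, p ≠ q ∧ u ∈ p ∧ v ∈ q)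

/-- `S` is `η`-well-connected with respect to `x`: for every partition `Q` of `S` into
nonempty parts, `η·x(δ_{G[S]}(Q)) ≥ |Q| − 1`. -/
def WellConnected [Fintype V] (G : SimpleGraph V) (x : Sym2 V → ℝ) (η : ℝ) (S : Set V) :
    Prop :=
  ∀ Q : Finset (Set V), IsPartitionOf S Q →
    (Q.card : ℝ) - 1 ≤ η * ∑ e ∈ partitionCut G Q, x e

theorem IsPartitionOf.subset {S : Set V} {Q : Finset (Set V)} (hQ : IsPartitionOf S Q)
    {q : Set V} (hq : q ∈ Q) : q ⊆ S := by
  rw [← hQ.2.2]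
  exact Set.subset_biUnion_of_mem (u := fun q => q) hq

/-- A part of a partition meets no other part, so neither do the sets inside it. -/
theorem IsPartitionOf.disjoint_of_mem_erase {S p q r : Set V} {P Q : Finset (Set V)}
    (hP : IsPartitionOf S P) (hp : p ∈ P) (hQ : IsPartitionOf p Q) (hr : r ∈ P.erase p)
    (hq : q ∈ Q) : Disjoint r q :=
  (hP.2.1 (mem_of_mem_erase hr) hp (ne_of_mem_erase hr)).mono_right (hQ.subset hq)

/-- Replacing a part `p` of a partition by the parts of a partition of `p` gives a partition. -/
theorem IsPartitionOf.refine {S p : Set V} {P Q : Finset (Set V)}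
    (hP : IsPartitionOf S P) (hp : p ∈ P) (hQ : IsPartitionOf p Q) :
    IsPartitionOf S (P.erase p ∪ Q) := by
  refine ⟨fun r hr => ?_, fun r hr s hs hrs => ?_, ?_⟩
  · rcases mem_union.1 hr with hr | hr
    · exact hP.1 r (mem_of_mem_erase hr)
    · exact hQ.1 r hr
  · rcases mem_union.1 hr with hr | hr <;> rcases mem_union.1 hs with hs | hs
    · exact hP.2.1 (mem_of_mem_erase hr) (mem_of_mem_erase hs) hrs
    · exact hP.disjoint_of_mem_erase hp hQ hr hs
    · exact (hP.disjoint_of_mem_erase hp hQ hs hr).symm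
    · exact hQ.2.1 hr hs hrs
  · rw [Finset.set_biUnion_union, hQ.2.2, Set.union_comm,
      ← Finset.set_biUnion_insert p (P.erase p) (fun r => r), insert_erase hp, hP.2.2]

theorem IsPartitionOf.card_refine {S p : Set V} {P Q : Finset (Set V)}
    (hP : IsPartitionOf S P) (hp : p ∈ P) (hQ : IsPartitionOf p Q) :
    (P.erase p ∪ Q).card + 1 = P.card + Q.card := by
  have hdisj : Disjoint (P.erase p) Q := by
    refine Finset.disjoint_left.2 fun r hr hrQ => ?_
    exact (hQ.1 r hrQ).ne_empty
      (disjoint_self.1 (hP.disjoint_of_mem_erase hp hQ hr hrQ))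
  rw [card_union_of_disjoint hdisj, ← card_erase_add_one hp]
  omega

theorem partitionCut_refine_subset [Fintype V] (G : SimpleGraph V) {p : Set V}
    {P Q : Finset (Set V)} (hp : p ∈ P) (hQ : IsPartitionOf p Q) :
    partitionCut G (P.erase p ∪ Q) ⊆ partitionCut G P ∪ partitionCut G Q := by
  intro e he
  simp only [partitionCut, mem_union, mem_filter, mem_univ, true_and] at he ⊢
  obtain ⟨heG, u, v, rfl, r, hr, s, hs, hrs, hu, hv⟩ := he
  rcases hr with hr | hr <;> rcases hs with hs | hs
  · exact .inl ⟨heG, u, v, rfl, r, mem_of_mem_erase hr, s, mem_of_mem_erase hs, hrs, hu, hv⟩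
  · exact .inl ⟨heG, u, v, rfl, r, mem_of_mem_erase hr, p, hp, ne_of_mem_erase hr, hu,
      hQ.subset hs hv⟩
  · exact .inl ⟨heG, u, v, rfl, p, hp, s, mem_of_mem_erase hs, (ne_of_mem_erase hs).symm,
      hQ.subset hr hu, hv⟩
  · exact .inr ⟨heG, u, v, rfl, r, hr, s, hs, hrs, hu, hv⟩

/-- every part of a minimizing partition is `η`-well-connected. -/
theorem parts_of_min_partition_wellConnected [Fintype V] (G : SimpleGraph V)
    (x : Sym2 V → ℝ) (hx : ∀ e, 0 ≤ x e) (η : ℝ) (hη : 0 < η)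
    (P : Finset (Set V)) (hP : IsPartitionOf (Set.univ : Set V) P)
    (hmin : ∀ P' : Finset (Set V), IsPartitionOf (Set.univ : Set V) P' →
      η * (∑ e ∈ partitionCut G P, x e) - ((P.card : ℝ) - 1) ≤
        η * (∑ e ∈ partitionCut G P', x e) - ((P'.card : ℝ) - 1)) :
    ∀ p ∈ P, WellConnected G x η p := by
  intro p hp Q hQ
  have hcard : ((P.erase p ∪ Q).card : ℝ) + 1 = P.card + Q.card := by
    exact_mod_cast hP.card_refine hp hQ
  have hsum : ∑ e ∈ partitionCut G (P.erase p ∪ Q), x e ≤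
      ∑ e ∈ partitionCut G P, x e + ∑ e ∈ partitionCut G Q, x e := by
    rw [← sum_union_inter]
    exact (sum_le_sum_of_subset_of_nonneg (partitionCut_refine_subset G hp hQ)
      fun e _ _ => hx e).trans (le_add_of_nonneg_right (sum_nonneg fun e _ => hx e))
  have hle := mul_le_mul_of_nonneg_left hsum hη.le
  have hmin' := hmin _ (hP.refine hp hQ)
  linarith
end
end

section
/- Let G=(V,E) be a finite connected graph, let x be a point of the spanning tree polytope of G, let η > 0, and let S ⊆ V. Suppose S₁, …, S_r are pairwise disjoint subsets of S each of which is η-well-connected with respect to x. Then S is η-well-connected with respect to x (i.e., η·x(δ_{G[S]}(Q)) ≥ |Q| − 1 for every partition Q of S into nonempty parts) if and only if η·x(δ_{G[S]}(P)) ≥ |P| − 1 holds for every partition P of S into nonempty parts in which each Sᵢ is entirely contained in a single part. -/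
open scoped Classical
open Finset

noncomputable section

variable {V : Type}

/-- Points of the spanning tree polytope have nonnegative coordinates. -/
theorem stPolytope_nonneg [Fintype V] {G : SimpleGraph V} {x : Sym2 V → ℝ}
    (hx : x ∈ stPolytope G) : 0 ≤ x := by
  refine convexHull_min ?_ (convex_Ici (𝕜 := ℝ) (0 : Sym2 V → ℝ)) hx
  rintro y ⟨T, -, -, rfl⟩ e
  dsimp only
  split_ifs <;> norm_num

/-- The parts of `P` that meet `A`. -/
def partsMeeting (P : Finset (Set V)) (A : Set V) : Finset (Set V) :=
  P.filter fun p => (p ∩ A).Nonempty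

/-- The partition obtained from `P` by merging all parts that meet `A`. -/
def mergeParts (P : Finset (Set V)) (A : Set V) : Finset (Set V) :=
  insert (⋃ p ∈ partsMeeting P A, p) (P \ partsMeeting P A)

/-- The partition of `A` induced by `P`. -/
def traceParts (P : Finset (Set V)) (A : Set V) : Finset (Set V) :=
  (partsMeeting P A).image (· ∩ A)

theorem mem_partsMeeting {P : Finset (Set V)} {A p : Set V} :
    p ∈ partsMeeting P A ↔ p ∈ P ∧ (p ∩ A).Nonempty := by
  simp [partsMeeting]

theorem IsPartitionOf.eq_of_mem {S : Set V} {P : Finset (Set V)} (hP : IsPartitionOf S P)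
    {p q : Set V} (hp : p ∈ P) (hq : q ∈ P) {v : V} (hvp : v ∈ p) (hvq : v ∈ q) : p = q := by
  by_contra h
  exact Set.disjoint_left.mp (hP.2.1 hp hq h) hvp hvq

theorem IsPartitionOf.exists_mem {S : Set V} {P : Finset (Set V)} (hP : IsPartitionOf S P)
    {v : V} (hv : v ∈ S) : ∃ p ∈ P, v ∈ p := by
  rw [← hP.2.2] at hv
  simpa using hv

theorem IsPartitionOf.subset_biUnion_partsMeeting {S A : Set V} {P : Finset (Set V)}
    (hP : IsPartitionOf S P) (hA : A ⊆ S) : A ⊆ ⋃ p ∈ partsMeeting P A, p := by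
  intro v hv
  obtain ⟨p, hp, hvp⟩ := hP.exists_mem (hA hv)
  exact Set.mem_biUnion (mem_partsMeeting.mpr ⟨hp, v, hvp, hv⟩) hvp

theorem IsPartitionOf.traceParts {S A : Set V} {P : Finset (Set V)}
    (hP : IsPartitionOf S P) (hA : A ⊆ S) : IsPartitionOf A (traceParts P A) := by
  refine ⟨?_, ?_, ?_⟩
  · intro p hp
    obtain ⟨q, hq, rfl⟩ := Finset.mem_image.mp hp
    exact (mem_partsMeeting.mp hq).2
  · intro p hp q hq hpq
    obtain ⟨p, hp', rfl⟩ := Finset.mem_image.mp hp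
    obtain ⟨q, hq', rfl⟩ := Finset.mem_image.mp hq
    have hne : p ≠ q := fun h => hpq (by rw [h])
    exact (hP.2.1 (mem_partsMeeting.mp hp').1 (mem_partsMeeting.mp hq').1 hne).mono
      Set.inter_subset_left Set.inter_subset_left
  · ext v
    constructor
    · intro hv
      obtain ⟨p, hp, hvp⟩ := Set.mem_iUnion₂.mp hv
      obtain ⟨q, -, rfl⟩ := Finset.mem_image.mp hp
      exact hvp.2
    · intro hv
      obtain ⟨p, hp, hvp⟩ := Set.mem_iUnion₂.mp (hP.subset_biUnion_partsMeeting hA hv)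
      exact Set.mem_biUnion (Finset.mem_coe.mpr (Finset.mem_image_of_mem _ hp)) ⟨hvp, hv⟩

theorem IsPartitionOf.card_traceParts {S : Set V} {P : Finset (Set V)}
    (hP : IsPartitionOf S P) (A : Set V) :
    (_root_.traceParts P A).card = (partsMeeting P A).card := by
  refine Finset.card_image_of_injOn ?_
  intro p hp q hq hpq
  obtain ⟨hp, v, hv⟩ := mem_partsMeeting.mp hp
  have hv' : v ∈ q ∩ A := (show p ∩ A = q ∩ A from hpq) ▸ hv
  exact hP.eq_of_mem hp (mem_partsMeeting.mp hq).1 hv.1 hv'.1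

theorem IsPartitionOf.mergeParts {S A : Set V} {P : Finset (Set V)}
    (hP : IsPartitionOf S P) (hne : (partsMeeting P A).Nonempty) :
    IsPartitionOf S (mergeParts P A) := by
  have hdis : ∀ q ∈ P \ partsMeeting P A, Disjoint (⋃ p ∈ partsMeeting P A, p) q := by
    intro q hq
    obtain ⟨hq, hqA⟩ := Finset.mem_sdiff.mp hq
    refine Set.disjoint_left.mpr fun v hv hvq => ?_
    obtain ⟨p, hp, hvp⟩ := Set.mem_iUnion₂.mp hv
    exact hqA (hP.eq_of_mem (mem_partsMeeting.mp hp).1 hq hvp hvq ▸ hp)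
  refine ⟨?_, ?_, ?_⟩
  · intro p hp
    rcases Finset.mem_insert.mp hp with rfl | hp
    · obtain ⟨q, hq⟩ := hne
      obtain ⟨v, hv⟩ := hP.1 q (mem_partsMeeting.mp hq).1
      exact ⟨v, Set.mem_biUnion hq hv⟩
    · exact hP.1 p (Finset.mem_sdiff.mp hp).1
  · intro p hp q hq hpq
    rcases Finset.mem_insert.mp hp with rfl | hp <;> rcases Finset.mem_insert.mp hq with rfl | hq
    · exact absurd rfl hpq
    · exact hdis q hq
    · exact (hdis p hp).symm
    · exact hP.2.1 (Finset.mem_sdiff.mp hp).1 (Finset.mem_sdiff.mp hq).1 hpq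
  · have hsub : partsMeeting P A ⊆ P := Finset.filter_subset _ _
    rw [← hP.2.2]
    ext v
    simp only [_root_.mergeParts, Finset.mem_insert, Finset.mem_sdiff, Set.mem_iUnion, exists_prop]
    constructor
    · rintro ⟨p, rfl | hp, hv⟩
      · obtain ⟨q, hq, hv⟩ := Set.mem_iUnion₂.mp hv
        exact ⟨q, hsub hq, hv⟩
      · exact ⟨p, hp.1, hv⟩
    · rintro ⟨p, hp, hv⟩
      by_cases hpA : p ∈ partsMeeting P A
      · exact ⟨_, Or.inl rfl, Set.mem_biUnion hpA hv⟩
      · exact ⟨p, Or.inr ⟨hp, hpA⟩, hv⟩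

theorem card_mergeParts {P : Finset (Set V)} {A : Set V}
    (hne : (partsMeeting P A).Nonempty) :
    (mergeParts P A).card + (partsMeeting P A).card = P.card + 1 := by
  have hnot : (⋃ p ∈ partsMeeting P A, p) ∉ P \ partsMeeting P A := by
    intro h
    obtain ⟨h, hn⟩ := Finset.mem_sdiff.mp h
    obtain ⟨q, hq⟩ := hne
    obtain ⟨v, hv⟩ := (mem_partsMeeting.mp hq).2
    exact hn (mem_partsMeeting.mpr ⟨h, v, Set.mem_biUnion hq hv.1, hv.2⟩)
  have hsub : partsMeeting P A ⊆ P := Finset.filter_subset _ _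
  have := Finset.card_sdiff_add_card_eq_card hsub
  rw [mergeParts, Finset.card_insert_of_notMem hnot]
  omega

theorem partitionCut_traceParts_subset [Fintype V] (G : SimpleGraph V) (P : Finset (Set V))
    (A : Set V) : partitionCut G (traceParts P A) ⊆ partitionCut G P := by
  intro e he
  obtain ⟨-, heG, u, v, rfl, p, hp, q, hq, hpq, hu, hv⟩ := Finset.mem_filter.mp he
  obtain ⟨p, hp', rfl⟩ := Finset.mem_image.mp hp
  obtain ⟨q, hq', rfl⟩ := Finset.mem_image.mp hq
  exact Finset.mem_filter.mpr ⟨Finset.mem_univ _, heG, u, v, rfl, p, (mem_partsMeeting.mp hp').1,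
    q, (mem_partsMeeting.mp hq').1, fun h => hpq (by rw [h]), hu.1, hv.1⟩

theorem partitionCut_mergeParts_subset [Fintype V] (G : SimpleGraph V) (P : Finset (Set V))
    (A : Set V) : partitionCut G (mergeParts P A) ⊆ partitionCut G P := by
  have key : ∀ p ∈ mergeParts P A, ∀ u ∈ p, ∃ p' ∈ P, u ∈ p' ∧
      (p = (⋃ p ∈ partsMeeting P A, p) ∧ p' ∈ partsMeeting P A ∨
        p = p' ∧ p' ∉ partsMeeting P A) := by
    intro p hp u hu
    rcases Finset.mem_insert.mp hp with rfl | hp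
    · obtain ⟨q, hq, huq⟩ := Set.mem_iUnion₂.mp hu
      exact ⟨q, (mem_partsMeeting.mp hq).1, huq, Or.inl ⟨rfl, hq⟩⟩
    · obtain ⟨hp, hpA⟩ := Finset.mem_sdiff.mp hp
      exact ⟨p, hp, hu, Or.inr ⟨rfl, hpA⟩⟩
  intro e he
  obtain ⟨-, heG, u, v, rfl, p, hp, q, hq, hpq, hu, hv⟩ := Finset.mem_filter.mp he
  obtain ⟨p', hp', hu', hpp⟩ := key p hp u hu
  obtain ⟨q', hq', hv', hqq⟩ := key q hq v hv
  refine Finset.mem_filter.mpr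
    ⟨Finset.mem_univ _, heG, u, v, rfl, p', hp', q', hq', ?_, hu', hv'⟩
  rintro rfl
  rcases hpp with ⟨h1, h2⟩ | ⟨h1, h2⟩ <;> rcases hqq with ⟨h3, h4⟩ | ⟨h3, h4⟩
  · exact hpq (h1.trans h3.symm)
  · exact h4 h2
  · exact h2 h4
  · exact hpq (h1.trans h3.symm)

theorem IsPartitionOf.disjoint_partitionCut [Fintype V] (G : SimpleGraph V) {S A : Set V}
    {P : Finset (Set V)} (hP : IsPartitionOf S P) (hA : A ⊆ S)
    (hne : (partsMeeting P A).Nonempty) :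
    Disjoint (partitionCut G (_root_.mergeParts P A))
      (partitionCut G (_root_.traceParts P A)) := by
  have hM := hP.mergeParts hne
  have hAM := hP.subset_biUnion_partsMeeting hA
  have huniq : ∀ p ∈ _root_.mergeParts P A, ∀ u ∈ p, u ∈ A → p = ⋃ p ∈ partsMeeting P A, p :=
    fun p hp u hu huA => hM.eq_of_mem hp (Finset.mem_insert_self _ _) hu (hAM huA)
  refine Finset.disjoint_left.mpr fun e he he' => ?_
  obtain ⟨-, -, u, v, rfl, p, hp, q, hq, hpq, hu, hv⟩ := Finset.mem_filter.mp he
  obtain ⟨-, -, a, b, hab, p', hp', q', hq', -, ha, hb⟩ := Finset.mem_filter.mp he'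
  obtain ⟨p', -, rfl⟩ := Finset.mem_image.mp hp'
  obtain ⟨q', -, rfl⟩ := Finset.mem_image.mp hq'
  have huv : u ∈ A ∧ v ∈ A := by
    rcases Sym2.eq_iff.mp hab with ⟨rfl, rfl⟩ | ⟨rfl, rfl⟩
    · exact ⟨ha.2, hb.2⟩
    · exact ⟨hb.2, ha.2⟩
  exact hpq ((huniq p hp u hu huv.1).trans (huniq q hq v hv huv.2).symm)

/-- If the merged partition satisfies the well-connectedness inequality and the merged set is
well-connected, then the original partition satisfies the inequality too. -/
theorem IsPartitionOf.card_sub_one_le_of_mergeParts [Fintype V] (G : SimpleGraph V)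
    {x : Sym2 V → ℝ} (hx : 0 ≤ x) {η : ℝ} (hη : 0 ≤ η) {S A : Set V} {P : Finset (Set V)}
    (hP : IsPartitionOf S P) (hA : A ⊆ S) (hne : (partsMeeting P A).Nonempty)
    (hwc : WellConnected G x η A)
    (hM : ((_root_.mergeParts P A).card : ℝ) - 1 ≤
      η * ∑ e ∈ partitionCut G (_root_.mergeParts P A), x e) :
    (P.card : ℝ) - 1 ≤ η * ∑ e ∈ partitionCut G P, x e := by
  have hT := hwc _ (hP.traceParts hA)
  rw [hP.card_traceParts] at hT
  have hcard : ((_root_.mergeParts P A).card : ℝ) + (partsMeeting P A).card = P.card + 1 := by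
    exact_mod_cast card_mergeParts hne
  have hsum := Finset.sum_le_sum_of_subset_of_nonneg
    (Finset.union_subset (partitionCut_mergeParts_subset G P A)
      (partitionCut_traceParts_subset G P A)) (fun e _ _ => hx e)
  rw [Finset.sum_union (hP.disjoint_partitionCut G hA hne)] at hsum
  have := mul_le_mul_of_nonneg_left hsum hη
  rw [mul_add] at this
  linarith

/-- well-connectedness can be checked on partitions that do not split
given disjoint well-connected subsets. -/
theorem wellConnected_iff_of_contract [Fintype V] (G : SimpleGraph V) (hG : G.Connected)
    (x : Sym2 V → ℝ) (hx : x ∈ stPolytope G) (η : ℝ) (hη : 0 < η)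
    (S : Set V) (r : ℕ) (Ssub : Fin r → Set V)
    (hsub : ∀ i, Ssub i ⊆ S)
    (hdisj : ∀ i j, i ≠ j → Disjoint (Ssub i) (Ssub j))
    (hwc : ∀ i, WellConnected G x η (Ssub i)) :
    WellConnected G x η S ↔
      ∀ P : Finset (Set V), IsPartitionOf S P → (∀ i, ∃ p ∈ P, Ssub i ⊆ p) →
        (P.card : ℝ) - 1 ≤ η * ∑ e ∈ partitionCut G P, x e := by
  have hx0 := stPolytope_nonneg hx
  refine ⟨fun h P hP _ => h P hP, fun h Q hQ => ?_⟩
  induction hn : Q.card using Nat.strong_induction_on generalizing Q with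
  | _ n ih =>
    subst hn
    rcases Q.eq_empty_or_nonempty with rfl | ⟨q₀, hq₀⟩
    · have := mul_nonneg hη.le
        (Finset.sum_nonneg fun e (_ : e ∈ partitionCut G (∅ : Finset (Set V))) => hx0 e)
      rw [Finset.card_empty, Nat.cast_zero]
      linarith
    by_cases hall : ∀ i, ∃ p ∈ Q, Ssub i ⊆ p
    · exact h Q hQ hall
    push Not at hall
    obtain ⟨i, hi⟩ := hall
    have hcover := hQ.subset_biUnion_partsMeeting (hsub i)
    have hne : (partsMeeting Q (Ssub i)).Nonempty := by
      obtain ⟨v, hv, -⟩ := Set.not_subset.mp (hi q₀ hq₀)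
      obtain ⟨p, hp, -⟩ := Set.mem_iUnion₂.mp (hcover hv)
      exact ⟨p, hp⟩
    have htwo : 1 < (partsMeeting Q (Ssub i)).card := by
      refine lt_of_le_of_ne hne.card_pos fun hone => ?_
      obtain ⟨p, hp⟩ := Finset.card_eq_one.mp hone.symm
      have hpQ : p ∈ Q :=
        (mem_partsMeeting.mp (hp ▸ Finset.mem_singleton_self p : p ∈ partsMeeting Q (Ssub i))).1
      rw [hp] at hcover
      exact hi p hpQ (by simpa using hcover)
    have hcard := card_mergeParts hne
    exact hQ.card_sub_one_le_of_mergeParts G hx0 hη.le (hsub i) hne (hwc i)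
      (ih _ (by omega) _ (hQ.mergeParts hne) rfl)
end
end
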